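/- arXiv:2103.07258 — 4 statements merged into one kernel-verified Lean document; each statement's English description precedes it below -/
import Mathlib

section
/- (Two Subcontainers) Let s₁, h₁, h₂, sₙ be reals, set z₂ := T(−T⁻¹(s₁) + h₁ + h₂), w₁ := w(T⁻¹(s₁), h₁) and w₂ := w(T⁻¹(s₁) − h₁, h₂), and suppose 0 < z₂ < sₙ ≤ h₂ ≤ h₁ ≤ s₁, 0.295 ≤ s₁ ≤ √(8/5), and h₁ + h₂ ≤ 1 + T⁻¹(s₁). Then F_{SC₂} := s₁² + sₙ² + E(s₁, sₙ) + B₄(T⁻¹(s₁), h₁, w₁, h₂) + B₄(T⁻¹(s₁) − h₁, h₂, w₂, sₙ) > 8/5. -/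
noncomputable section

/-- T⁻¹(s) = √(1 − s²/4) − s. -/
def Tinv (s : ℝ) : ℝ := Real.sqrt (1 - s ^ 2 / 4) - s

/-- T(u) = (2/5)(√(5 − u²) − 2u). -/
def Tfun (u : ℝ) : ℝ := 2 / 5 * (Real.sqrt (5 - u ^ 2) - 2 * u)

/-- s₁* = √((2 + √2)/3). -/
def s1star : ℝ := Real.sqrt ((2 + Real.sqrt 2) / 3)

/-- σ(s₁), the side length of the largest square fitting into a side pocket. -/
def sigma (s₁ : ℝ) : ℝ :=
  if s₁ ≤ s1star then
    1 / 4 * (-s₁ - 2 * Tinv s₁ + Real.sqrt (8 - (s₁ - 2 * Tinv s₁) ^ 2))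
  else
    1 / 5 * (Real.sqrt (20 - s₁ ^ 2) - 2 * s₁)

/-- w(y_t, h) = 2√(min{1 − y_t², 1 − (y_t − h)²}). -/
def wfun (yt h : ℝ) : ℝ := 2 * Real.sqrt (min (1 - yt ^ 2) (1 - (yt - h) ^ 2))

/-- X(a, b, u). -/
def Xfun (a b u : ℝ) : ℝ :=
  if u ≤ 2 * min a (-b) then Tinv u else Real.sqrt (1 - (u - min a (-b)) ^ 2) - u

/-- Y(a, h, w, h′) = w/2 − h + X(a, a − h, h′). -/
def Yfun (a h w h' : ℝ) : ℝ := w / 2 - h + Xfun a (a - h) h'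

/-- B₁(h, w, h′). -/
def B1 (h w h' : ℝ) : ℝ :=
  max (h * w / 2 + h ^ 2 / 4) (max (h ^ 2 + (w - h - h') * h') (h * (w + h) / 2 - h' ^ 2))

/-- B₂(h, w, h′). -/
def B2 (h w h' : ℝ) : ℝ :=
  if w < h + h' then h ^ 2
  else if w < 2 * h then h ^ 2 + h' ^ 2
  else B1 h w h'

/-- B₃(a, h, w, h′). -/
def B3 (a h w h' : ℝ) : ℝ :=
  max (h ^ 2 + max (Yfun a h w h') 0 * h')
      (h ^ 2 + min (max (Yfun a h w h') 0 ^ 2) (2 * h' ^ 2))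

/-- B₄(a, h, w, h′). -/
def B4 (a h w h' : ℝ) : ℝ := max (B2 h w h') (B3 a h w h')

/-- E(s₁, sₙ). -/
def Efun (s₁ sn : ℝ) : ℝ := if sn ≤ sigma s₁ then 0.83 * sigma s₁ ^ 2 else 0

/-- A(δ), the area of a circular segment of the unit disk of height δ. -/
def Aseg (δ : ℝ) : ℝ := Real.arccos (1 - δ) - (1 - δ) * Real.sqrt (1 - (1 - δ) ^ 2)

/-- B₅(h, H) = A(H − h) + h² − H·h. -/
def B5 (h H : ℝ) : ℝ := Aseg (H - h) + h ^ 2 - H * h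

/-- B₆(H_R, W_R, h′) = H_R·W_R/2 + h′·H_R/4. -/
def B6 (HR WR h' : ℝ) : ℝ := HR * WR / 2 + h' * HR / 4

/-- Evaluates `x` before substituting it into `f` when the kernel computes. -/
def force {α : Type} (x : ℕ) (f : ℕ → α) : α :=
  Nat.casesOn x (f 0) fun n => f n.succ

def natMax (a b : ℕ) : ℕ := force a fun a => a + (b - a)

def natMin (a b : ℕ) : ℕ := force a fun a => a - (a - b)

/-- Four Newton steps towards `√x`, starting from `20000`, combined to a lower bound. -/
def sqrtLower (x : ℕ) : ℕ :=
  force ((20000 + x / 20000) / 2) fun r => force ((r + x / r) / 2) fun r =>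
  force ((r + x / r) / 2) fun r => force ((r + x / r) / 2) fun r => natMin r (x / r)

def sqrtUpper (x : ℕ) : ℕ :=
  force (sqrtLower x) fun r => bif Nat.ble x ((r + 2) * (r + 2)) then r + 2 else x

def cosLower (m : ℕ) : ℕ := sqrtLower (100000000 - m * m)

def sigmaLower (sL sH : ℕ) : ℕ :=
  force ((880000 + 480 * sL) / 1000) fun x => force ((2280000 + 250 * sL) / 1000) fun y =>
  force (natMin x y) fun x => force (bif Nat.ble sH 10660 then 4400 else 3500) fun y =>
  natMin x y

/-- Certifies that the total area exceeds `8 / 5` when the last square has side in `[lo, hi]`, where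
`tot` and `bonus` bound the contributions that do not depend on this side. -/
def pocketCheck (tot qL sH aH bH u v2 bonus lo hi : ℕ) : Bool :=
  Nat.ble (hi + 1) lo ||
  force (cosLower (natMax (hi / 2 + 1) (natMax (hi + aH + sH - qL) (hi - u)))) fun R2 =>
  force (v2 + R2 - bH) fun g =>
  Nat.ble 16000000001 (100 * (tot + lo * natMax lo g) + bonus)

/-- Certifies the area bound for `(s₁, h₁, h₂)` in `[sL, sH] × [aL, aH] × [bL, bH]`, all in units of
`10⁻⁴`, by interval arithmetic. -/
def leafCheck (sL sH aL aH bL bH : ℕ) : Bool :=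
  Nat.ble (sH + 1) aL || Nat.ble (aH + 1) bL ||
  force (sqrtLower (100000000 - (sH * sH / 4 + 1))) fun qL =>
  force (sqrtUpper (100000000 - sL * sL / 4)) fun qH =>
  Nat.ble (qH + 10000) (aL + bL + sL) ||
  force (natMin 10000 (aH + bH + sH - qL)) fun U =>
  force (aL + bL + sL - qH) fun u =>
  force (2 * (sqrtLower (500000000 - U * U) - 2 * U) / 5) fun z =>
  Nat.ble (bH + 1) z ||
  force (sigmaLower sL sH) fun σ =>
  force (cosLower (natMax (qH - sL) (aH + sH - qL))) fun v1 =>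
  force (cosLower (natMax (bH / 2 + 1) (natMax (bH + sH - qL) (bH + qH - (aL + sL))))) fun R1 =>
  force (cosLower (natMax (qH - (sL + aL)) U)) fun v2 =>
  force (sL * sL + aL * aL + bL * bL + bL * (v1 + R1 - (aH + bH))) fun tot =>
  force (natMax z σ) fun m =>
  force ((m + bH) / 2) fun h =>
  pocketCheck tot qL sH aH bH u v2 (83 * (σ * σ)) z (natMin σ bH) &&
  pocketCheck tot qL sH aH bH u v2 0 m h &&
  pocketCheck tot qL sH aH bH u v2 0 h bH

/-- Certifies the area bound on a box by bisecting its longest side recursively. -/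
def boxCheck : ℕ → ℕ → ℕ → ℕ → ℕ → ℕ → ℕ → Bool
  | 0, _, _, _, _, _, _ => false
  | k + 1, sL, sH, aL, aH, bL, bH =>
    leafCheck sL sH aL aH bL bH ||
    force (sH - sL) fun x => force (aH - aL) fun y => force (bH - bL) fun w =>
    bif Nat.ble y x && Nat.ble w x then
      force ((sL + sH) / 2) fun m =>
        boxCheck k sL m aL aH bL bH && boxCheck k m sH aL aH bL bH
    else bif Nat.ble w y then
      force ((aL + aH) / 2) fun m =>
        boxCheck k sL sH aL m bL bH && boxCheck k sL sH m aH bL bH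
    else
      force ((bL + bH) / 2) fun m =>
        boxCheck k sL sH aL aH bL m && boxCheck k sL sH aL aH m bH

theorem of_force {x : ℕ} {f : ℕ → Bool} (h : force x f = true) : ∃ y, y = x ∧ f y = true := by
  cases x with
  | zero => exact ⟨0, rfl, h⟩
  | succ n => exact ⟨n + 1, rfl, h⟩

theorem force_eq {α : Type} (x : ℕ) (f : ℕ → α) : force x f = f x := by
  cases x <;> rfl

theorem natMax_eq (a b : ℕ) : natMax a b = max a b := by
  simp only [natMax, force_eq]; omega

theorem natMin_eq (a b : ℕ) : natMin a b = min a b := by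
  simp only [natMin, force_eq]; omega

theorem sqrtLower_sq_le (x : ℕ) : sqrtLower x * sqrtLower x ≤ x := by
  simp only [sqrtLower, force_eq, natMin_eq]
  generalize (_ + _ / _) / 2 = r
  exact (Nat.mul_le_mul (min_le_left _ _) (min_le_right _ _)).trans (Nat.mul_div_le x r)

theorem le_sqrtUpper_sq (x : ℕ) : x ≤ sqrtUpper x * sqrtUpper x := by
  simp only [sqrtUpper, force_eq]
  cases h : Nat.ble x ((sqrtLower x + 2) * (sqrtLower x + 2)) with
  | true => exact Nat.le_of_ble_eq_true h
  | false => exact Nat.le_mul_self x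

/-- The real number represented by a natural number in units of `10⁻⁴`. -/
def unscale (a : ℕ) : ℝ := a / 10000

theorem unscale_nonneg (a : ℕ) : 0 ≤ unscale a := by unfold unscale; positivity

theorem unscale_add (a b : ℕ) : unscale (a + b) = unscale a + unscale b := by
  simp only [unscale]; push_cast; ring

theorem unscale_mono {a b : ℕ} (h : a ≤ b) : unscale a ≤ unscale b := by
  have : (a : ℝ) ≤ b := by exact_mod_cast h
  unfold unscale; linarith

theorem sub_le_unscale_sub (a b : ℕ) : unscale a - unscale b ≤ unscale (a - b) := by
  have h := unscale_mono (show a ≤ (a - b) + b by omega)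
  rw [unscale_add] at h
  linarith

theorem unscale_sub_le (a b : ℕ) : unscale (a - b) ≤ max (unscale a - unscale b) 0 := by
  rcases le_total b a with h | h
  · refine le_max_of_le_left ?_
    have h' := unscale_add (a - b) b
    rw [Nat.sub_add_cancel h] at h'
    linarith
  · rw [Nat.sub_eq_zero_of_le h]
    simp [unscale]

theorem unscale_max (a b : ℕ) : unscale (max a b) = max (unscale a) (unscale b) :=
  Monotone.map_max (f := unscale) fun _ _ h => unscale_mono h

theorem unscale_sqrtLower_le (x : ℕ) : unscale (sqrtLower x) ≤ √(x / 100000000) := by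
  apply Real.le_sqrt_of_sq_le
  have : (sqrtLower x : ℝ) * sqrtLower x ≤ x := by exact_mod_cast sqrtLower_sq_le x
  unfold unscale
  linarith [show ((sqrtLower x : ℝ) / 10000) ^ 2 = sqrtLower x * sqrtLower x / 100000000 by ring]

theorem le_unscale_sqrtUpper (x : ℕ) : √(x / 100000000) ≤ unscale (sqrtUpper x) := by
  apply Real.sqrt_le_iff.2 ⟨unscale_nonneg _, ?_⟩
  have : (x : ℝ) ≤ sqrtUpper x * sqrtUpper x := by exact_mod_cast le_sqrtUpper_sq x
  unfold unscale
  linarith [show ((sqrtUpper x : ℝ) / 10000) ^ 2 = sqrtUpper x * sqrtUpper x / 100000000 by ring]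

theorem unscale_sqrtLower_sub_le (c b : ℕ) {r x : ℝ} (hc : (c : ℝ) = 100000000 * r)
    (hb : 100000000 * x ≤ b) : unscale (sqrtLower (c - b)) ≤ √(r - x) := by
  rcases le_total b c with h | h
  · refine (unscale_sqrtLower_le _).trans (Real.sqrt_le_sqrt ?_)
    rw [Nat.cast_sub h]
    linarith
  · rw [Nat.sub_eq_zero_of_le h]
    have h0 := unscale_sqrtLower_le 0
    simp only [Nat.cast_zero, zero_div, Real.sqrt_zero] at h0
    exact h0.trans (Real.sqrt_nonneg _)

theorem le_unscale_sqrtUpper_sub (c b : ℕ) {r x : ℝ} (hc : (c : ℝ) = 100000000 * r)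
    (hb : b ≤ 100000000 * x) : √(r - x) ≤ unscale (sqrtUpper (c - b)) := by
  refine (Real.sqrt_le_sqrt ?_).trans (le_unscale_sqrtUpper _)
  have : (c : ℝ) - b ≤ (c - b : ℕ) := by
    rw [sub_le_iff_le_add]
    exact_mod_cast (show c ≤ c - b + b by omega)
  linarith

theorem unscale_cosLower_le (m : ℕ) : unscale (cosLower m) ≤ √(1 - unscale m ^ 2) := by
  refine unscale_sqrtLower_sub_le _ _ (by norm_num) (le_of_eq ?_)
  unfold unscale
  push_cast
  ring

theorem le_half_wfun {y h M : ℝ} (h₁ : |y| ≤ M) (h₂ : |y - h| ≤ M) :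
    √(1 - M ^ 2) ≤ wfun y h / 2 := by
  have h₁' : y ^ 2 ≤ M ^ 2 := sq_le_sq' (abs_le.1 h₁).1 (abs_le.1 h₁).2
  have h₂' : (y - h) ^ 2 ≤ M ^ 2 := sq_le_sq' (abs_le.1 h₂).1 (abs_le.1 h₂).2
  rw [wfun, mul_div_cancel_left₀ _ two_ne_zero]
  exact Real.sqrt_le_sqrt (le_min (by linarith) (by linarith))

theorem le_Xfun_add {a h u M : ℝ} (hu : 0 ≤ u) (h₁ : u / 2 ≤ M) (h₂ : u - a ≤ M)
    (h₃ : u + (a - h) ≤ M) : √(1 - M ^ 2) ≤ Xfun a (a - h) u + u := by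
  unfold Xfun Tinv
  split_ifs with hc
  · rw [sub_add_cancel]
    exact Real.sqrt_le_sqrt (by nlinarith)
  · rw [sub_add_cancel]
    have : u - min a (-(a - h)) ≤ M := by
      rcases min_choice a (-(a - h)) with h' | h' <;> rw [h'] <;> linarith
    exact Real.sqrt_le_sqrt (by nlinarith)

theorem le_B4 {a h w h' y : ℝ} (hh' : 0 ≤ h') (hy : y ≤ Yfun a h w h') :
    h ^ 2 + max y 0 * h' ≤ B4 a h w h' := by
  refine le_trans ?_ ((le_max_left _ _).trans (le_max_right _ _))
  gcongr

theorem mul_max_le_sq_add_B4 {a h w n lo g : ℝ} (hlo : 0 ≤ lo) (hn : lo ≤ n)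
    (hg : g ≤ w / 2 - h + (Xfun a (a - h) n + n)) :
    h ^ 2 + lo * max lo g ≤ n ^ 2 + B4 a h w n := by
  have h₁ := le_B4 (hlo.trans hn) (le_refl (Yfun a h w n))
  have h₂ : max lo g ≤ n + max (Yfun a h w n) 0 := by
    refine max_le ?_ ?_
    · linarith [le_max_right (Yfun a h w n) 0]
    · have := le_max_left (Yfun a h w n) 0
      unfold Yfun at this ⊢
      linarith
  have h₃ : lo * max lo g ≤ n * (n + max (Yfun a h w n) 0) :=
    mul_le_mul hn h₂ (hlo.trans (le_max_left _ _)) (hlo.trans hn)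
  nlinarith

theorem Tfun_anti {u U : ℝ} (hu : -1 ≤ u) (hU0 : 0 ≤ U) (huU : u ≤ U) :
    Tfun U ≤ Tfun u := by
  have key : √(5 - U ^ 2) ≤ √(5 - u ^ 2) - 2 * u + 2 * U := by
    rcases le_total 0 u with h | h
    · have := Real.sqrt_le_sqrt (show 5 - U ^ 2 ≤ 5 - u ^ 2 by nlinarith)
      linarith
    · have h1 : √(5 - U ^ 2) ≤ √5 := Real.sqrt_le_sqrt (by nlinarith)
      have h5 : 2 ≤ √5 := Real.le_sqrt_of_sq_le (by norm_num)
      have h2 : √5 + 2 * u ≤ √(5 - u ^ 2) := by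
        apply Real.le_sqrt_of_sq_le
        nlinarith [Real.sq_sqrt (show (0 : ℝ) ≤ 5 by norm_num)]
      linarith
  unfold Tfun
  linarith

theorem lt_one_of_Tfun_pos {u : ℝ} (h : 0 < Tfun u) : u < 1 := by
  by_contra! h1
  have : √(5 - u ^ 2) ≤ 2 := Real.sqrt_le_iff.2 ⟨by norm_num, by nlinarith⟩
  unfold Tfun at h
  linarith

theorem le_sigma_of_le_s1star {s p : ℝ} (hs : s ≤ s1star) (hs0 : 0 ≤ s) (hs2 : s ≤ 2)
    (h : s ^ 2 + 2 * p ^ 2 - p * s ≤ 2 * √(1 - s ^ 2 / 4) * (s - p)) : p ≤ sigma s := by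
  have hq := Real.sq_sqrt (show 0 ≤ 1 - s ^ 2 / 4 by nlinarith)
  rw [sigma, if_pos hs]
  unfold Tinv
  set q := √(1 - s ^ 2 / 4)
  have : 4 * p + 2 * q - s ≤ √(8 - (s - 2 * (q - s)) ^ 2) := by
    apply Real.le_sqrt_of_sq_le
    nlinarith
  linarith

theorem le_s1star : 1.066 ≤ s1star := by
  refine Real.le_sqrt_of_sq_le ?_
  have : 1.41421 ≤ √2 := Real.le_sqrt_of_sq_le (by norm_num)
  norm_num at this ⊢
  linarith

theorem s1star_le : s1star ≤ 1.067 := by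
  refine Real.sqrt_le_iff.2 ⟨by norm_num, ?_⟩
  have : √2 ≤ 1.41422 := Real.sqrt_le_iff.2 ⟨by norm_num, by norm_num⟩
  norm_num at this ⊢
  linarith

/-- A piecewise linear lower bound for `sigma` on its first branch. -/
theorem min_le_sigma {s : ℝ} (hs : 0.295 ≤ s) (hstar : s ≤ s1star) :
    min (min (0.088 + 0.48 * s) (0.228 + 0.25 * s)) 0.44 ≤ sigma s := by
  have hs' := hstar.trans s1star_le
  have hs0 : 0 ≤ s := by norm_num at hs; linarith
  have hs2 : s ≤ 2 := by norm_num at hs'; linarith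
  norm_num at hs hs' ⊢
  rcases le_total s (609 / 1000) with h₁ | h₁
  · have hq : 1 - 13 / 100 * s ^ 2 ≤ √(1 - s ^ 2 / 4) := by
      apply Real.le_sqrt_of_sq_le
      nlinarith [mul_nonneg (sq_nonneg s) (show 0 ≤ 0.59 - s ^ 2 by nlinarith)]
    refine Or.inl (Or.inl (le_sigma_of_le_s1star hstar hs0 hs2 ?_))
    have := mul_le_mul_of_nonneg_right hq (show 0 ≤ 13 / 25 * s - 11 / 125 by linarith)
    nlinarith [mul_nonneg (sub_nonneg.2 hs) (sub_nonneg.2 h₁),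
      mul_nonneg hs0 (mul_nonneg (sub_nonneg.2 hs) (sub_nonneg.2 h₁))]
  have hq : 1 - 136 / 1000 * s ^ 2 ≤ √(1 - s ^ 2 / 4) := by
    apply Real.le_sqrt_of_sq_le
    nlinarith [mul_nonneg (sq_nonneg s) (show 0 ≤ 1.14 - s ^ 2 by nlinarith)]
  rcases le_total s (848 / 1000) with h₂ | h₂
  · refine Or.inl (Or.inr (le_sigma_of_le_s1star hstar hs0 hs2 ?_))
    have := mul_le_mul_of_nonneg_right hq (show 0 ≤ 3 / 4 * s - 57 / 250 by linarith)
    nlinarith [mul_nonneg (sub_nonneg.2 h₁) (sub_nonneg.2 h₂),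
      mul_nonneg hs0 (mul_nonneg (sub_nonneg.2 h₁) (sub_nonneg.2 h₂))]
  · refine Or.inr (le_sigma_of_le_s1star hstar hs0 hs2 ?_)
    have := mul_le_mul_of_nonneg_right hq (show 0 ≤ s - 11 / 25 by linarith)
    nlinarith [mul_nonneg (sub_nonneg.2 h₂) (sub_nonneg.2 hs'),
      mul_nonneg hs0 (mul_nonneg (sub_nonneg.2 h₂) (sub_nonneg.2 hs'))]

theorem min_le_sigma_of_le {s : ℝ} (hs : 0.295 ≤ s) (hs' : s ≤ 1.265) :
    min (min (0.088 + 0.48 * s) (0.228 + 0.25 * s)) 0.35 ≤ sigma s := by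
  rcases le_or_gt s s1star with h | h
  · refine (min_le_min_left _ (by norm_num)).trans (min_le_sigma hs h)
  · refine (min_le_right _ _).trans ?_
    rw [sigma, if_neg h.not_ge]
    norm_num at hs hs' ⊢
    have : 7 / 4 + 2 * s ≤ √(20 - s ^ 2) := by
      apply Real.le_sqrt_of_sq_le
      nlinarith
    linarith

theorem unscale_min (a b : ℕ) : unscale (min a b) = min (unscale a) (unscale b) :=
  Monotone.map_min (f := unscale) fun _ _ h => unscale_mono h

theorem unscale_div_le (a b : ℕ) : unscale (a / b) ≤ unscale a / b := by
  have := Nat.cast_div_le (α := ℝ) (m := a) (n := b)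
  unfold unscale
  rw [div_right_comm]
  gcongr

theorem unscale_sigmaLower_le {s : ℝ} {sL sH : ℕ} (hs : 0.295 ≤ s) (hs' : s ≤ 1.265)
    (hL : unscale sL ≤ s) (hH : s ≤ unscale sH) : unscale (sigmaLower sL sH) ≤ sigma s := by
  have hx : unscale ((880000 + 480 * sL) / 1000) ≤ 0.088 + 0.48 * s := by
    refine (unscale_div_le _ _).trans ?_
    unfold unscale at hL ⊢
    push_cast
    linarith
  have hy : unscale ((2280000 + 250 * sL) / 1000) ≤ 0.228 + 0.25 * s := by
    refine (unscale_div_le _ _).trans ?_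
    unfold unscale at hL ⊢
    push_cast
    linarith
  simp only [sigmaLower, force_eq, natMin_eq, unscale_min]
  cases hb : Nat.ble sH 10660 with
  | true =>
    have := unscale_mono (Nat.le_of_ble_eq_true hb)
    refine le_trans ?_ (min_le_sigma hs ((hH.trans this).trans (le_trans ?_ le_s1star)))
    · exact min_le_min (min_le_min hx hy) (by norm_num [unscale])
    · norm_num [unscale]
  | false =>
    refine le_trans ?_ (min_le_sigma_of_le hs hs')
    exact min_le_min (min_le_min hx hy) (by norm_num [unscale])

theorem le_Efun {s n p : ℝ} (hp : 0 ≤ p) (hs : p ≤ sigma s) (hn : n ≤ p) :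
    0.83 * p ^ 2 ≤ Efun s n := by
  rw [Efun, if_pos (hn.trans hs)]
  gcongr

theorem Efun_nonneg (s n : ℝ) : 0 ≤ Efun s n := by
  unfold Efun
  split_ifs <;> positivity

theorem half_le_unscale {x : ℝ} {m : ℕ} (h : x ≤ unscale m) : x / 2 ≤ unscale (m / 2 + 1) := by
  have := unscale_mono (show m ≤ (m / 2 + 1) + (m / 2 + 1) by omega)
  rw [unscale_add] at this
  linarith

theorem lt_of_pocketCheck {tot qL sH aH bH u v bonus lo hi : ℕ} {a h w n : ℝ}
    (hcheck : pocketCheck tot qL sH aH bH u v bonus lo hi = true)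
    (hlo : unscale lo ≤ n) (hhi : n ≤ unscale hi)
    (ha : unscale qL - unscale sH - unscale aH ≤ a) (hu : unscale u ≤ h - a)
    (hv : unscale v ≤ w / 2) (hb : h ≤ unscale bH) :
    8 / 5 < tot / 10 ^ 8 + bonus / 10 ^ 10 + (n ^ 2 + B4 a h w n - h ^ 2) := by
  simp only [pocketCheck, force_eq, natMax_eq, Bool.or_eq_true, Nat.ble_eq] at hcheck
  rcases hcheck with hcheck | hcheck
  · have := unscale_mono hcheck
    rw [unscale_add] at this
    norm_num [unscale] at this hlo hhi
    linarith
  set M := max (hi / 2 + 1) (max (hi + aH + sH - qL) (hi - u))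
  have hR : unscale (cosLower M) ≤ Xfun a (a - h) n + n := by
    refine (unscale_cosLower_le M).trans (le_Xfun_add ((unscale_nonneg lo).trans hlo) ?_ ?_ ?_)
    · exact (half_le_unscale hhi).trans (unscale_mono (le_max_left _ _))
    · refine le_trans ?_ (unscale_mono ((le_max_left _ _).trans (le_max_right _ _)))
      have := sub_le_unscale_sub (hi + aH + sH) qL
      simp only [unscale_add] at this
      linarith
    · refine le_trans ?_ (unscale_mono ((le_max_right _ _).trans (le_max_right _ _)))
      have := sub_le_unscale_sub hi u
      linarith
  set g := v + cosLower M - bH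
  have hg := unscale_sub_le (v + cosLower M) bH
  rw [unscale_add] at hg
  have hmax : max (unscale lo) (unscale g) ≤
      max (unscale lo) (w / 2 - h + (Xfun a (a - h) n + n)) := by
    refine max_le (le_max_left _ _) (hg.trans (max_le ?_ ?_))
    · exact le_max_of_le_right (by linarith)
    · exact le_max_of_le_left (unscale_nonneg lo)
  have hB := mul_max_le_sq_add_B4 (unscale_nonneg lo) hlo
    (le_refl (w / 2 - h + (Xfun a (a - h) n + n)))
  have hmul := mul_le_mul_of_nonneg_left hmax (unscale_nonneg lo)
  rw [← unscale_max] at hmul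
  have hc : (16000000001 : ℝ) ≤ 100 * (tot + lo * (max lo g : ℕ)) + bonus := by
    exact_mod_cast hcheck
  have : unscale lo * unscale (max lo g) = lo * (max lo g : ℕ) / 10 ^ 8 := by
    unfold unscale; ring
  linarith

/-- The quantity bounded below in `two_subcontainers`. -/
def packedArea (s₁ h₁ h₂ sn : ℝ) : ℝ :=
  s₁ ^ 2 + sn ^ 2 + Efun s₁ sn + B4 (Tinv s₁) h₁ (wfun (Tinv s₁) h₁) h₂ +
    B4 (Tinv s₁ - h₁) h₂ (wfun (Tinv s₁ - h₁) h₂) sn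

/-- The constraints on the square sides and container heights used in `two_subcontainers`. -/
structure IsFeasible (s₁ h₁ h₂ sn : ℝ) : Prop where
  Tfun_pos : 0 < Tfun (-Tinv s₁ + h₁ + h₂)
  Tfun_lt : Tfun (-Tinv s₁ + h₁ + h₂) < sn
  sn_le : sn ≤ h₂
  h₂_le : h₂ ≤ h₁
  h₁_le : h₁ ≤ s₁
  le_s₁ : 0.295 ≤ s₁
  s₁_le : s₁ ≤ 1.265

theorem IsFeasible.nonneg {s₁ h₁ h₂ sn : ℝ} (hf : IsFeasible s₁ h₁ h₂ sn) :
    0 ≤ -Tinv s₁ + h₁ + h₂ := by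
  obtain ⟨hz0, hz, hn, h21, h1s, hs, hs'⟩ := hf
  norm_num at hs hs'
  have ht : Tinv s₁ ≤ 1 - s₁ :=
    sub_le_sub_right (Real.sqrt_le_one.2 (by nlinarith)) _
  by_contra! h
  have h0 := Tfun_anti (by linarith) le_rfl h.le
  have h5 : 2 ≤ √5 := Real.le_sqrt_of_sq_le (by norm_num)
  have : 4 / 5 ≤ Tfun 0 := by norm_num [Tfun]; linarith
  linarith

theorem lt_packedArea_of_leafCheck {s₁ h₁ h₂ sn : ℝ} (hf : IsFeasible s₁ h₁ h₂ sn)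
    {sL sH aL aH bL bH : ℕ} (hcheck : leafCheck sL sH aL aH bL bH = true)
    (hsL : unscale sL ≤ s₁) (hsH : s₁ ≤ unscale sH) (haL : unscale aL ≤ h₁)
    (haH : h₁ ≤ unscale aH) (hbL : unscale bL ≤ h₂) (hbH : h₂ ≤ unscale bH) :
    8 / 5 < packedArea s₁ h₁ h₂ sn := by
  have hu0 := hf.nonneg
  obtain ⟨hz0, hz, hn, h21, h1s, hs, hs'⟩ := hf
  have hu1 := lt_one_of_Tfun_pos hz0
  have not_lt : ∀ {a b : ℕ}, unscale a ≤ unscale b → ¬ b + 1 ≤ a := by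
    intro a b h h'
    have := unscale_mono h'
    rw [unscale_add] at this
    norm_num [unscale] at this h
    linarith
  have hn0 : 0 < sn := hz0.trans hz
  have hb0 : 0 ≤ h₂ := hn0.le.trans hn
  have hs0 : 0 ≤ s₁ := hb0.trans (h21.trans h1s)
  simp only [leafCheck, Bool.or_eq_true, Nat.ble_eq, not_lt (haL.trans (h1s.trans hsH)),
    not_lt (hbL.trans (h21.trans haH)), false_or] at hcheck
  obtain ⟨qL, hqL, hcheck⟩ := of_force hcheck
  obtain ⟨qH, hqH, hcheck⟩ := of_force hcheck
  have ht : Tinv s₁ = √(1 - s₁ ^ 2 / 4) - s₁ := rfl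
  set t := Tinv s₁
  replace hqL : unscale qL ≤ t + s₁ := by
    have hc : ((sH * sH : ℕ) : ℝ) ≤ (4 * (sH * sH / 4 + 1) : ℕ) := by
      exact_mod_cast (show sH * sH ≤ 4 * (sH * sH / 4 + 1) by omega)
    rw [ht, sub_add_cancel, hqL]
    refine unscale_sqrtLower_sub_le _ _ (by norm_num) ?_
    have := mul_self_le_mul_self hs0 hsH
    unfold unscale at this
    push_cast at hc ⊢
    linarith
  replace hqH : t + s₁ ≤ unscale qH := by
    have hc : ((4 * (sL * sL / 4) : ℕ) : ℝ) ≤ (sL * sL : ℕ) := by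
      exact_mod_cast Nat.mul_div_le _ _
    rw [ht, sub_add_cancel, hqH]
    refine le_unscale_sqrtUpper_sub _ _ (by norm_num) ?_
    have := mul_self_le_mul_self (unscale_nonneg sL) hsL
    unfold unscale at this
    push_cast at hc ⊢
    linarith
  have hone : unscale 10000 = 1 := by norm_num [unscale]
  simp only [Bool.or_eq_true, Nat.ble_eq] at hcheck
  rcases hcheck with hcheck | hcheck
  · have := unscale_mono hcheck
    simp only [unscale_add, hone] at this
    linarith
  obtain ⟨U, hU, hcheck⟩ := of_force hcheck
  obtain ⟨u, hu, hcheck⟩ := of_force hcheck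
  obtain ⟨z, hz', hcheck⟩ := of_force hcheck
  replace hu : unscale u ≤ -t + h₁ + h₂ := by
    rw [hu]
    refine (unscale_sub_le _ _).trans (max_le ?_ hu0)
    simp only [unscale_add]
    linarith
  replace hU : -t + h₁ + h₂ ≤ unscale U := by
    rw [hU, natMin_eq, unscale_min, hone]
    refine le_min hu1.le (le_trans ?_ (sub_le_unscale_sub _ _))
    simp only [unscale_add]
    linarith
  replace hz' : unscale z ≤ sn := by
    have hUz := Tfun_anti (by linarith) (unscale_nonneg U) hU
    have hsqrt : unscale (sqrtLower (500000000 - U * U)) ≤ √(5 - unscale U ^ 2) := by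
      refine unscale_sqrtLower_sub_le _ _ (by norm_num) (le_of_eq ?_)
      unfold unscale
      push_cast
      ring
    have hsub := unscale_sub_le (sqrtLower (500000000 - U * U)) (2 * U)
    have hdiv := unscale_div_le (2 * (sqrtLower (500000000 - U * U) - 2 * U)) 5
    rw [← hz', two_mul, unscale_add] at hdiv
    rw [show unscale (2 * U) = 2 * unscale U by rw [two_mul, unscale_add, two_mul]] at hsub
    push_cast at hdiv
    have hT : 2 / 5 * (√(5 - unscale U ^ 2) - 2 * unscale U) < sn := hUz.trans_lt hz
    rcases le_max_iff.1 hsub with h | h <;> linarith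
  simp only [Bool.or_eq_true, Nat.ble_eq, not_lt (hz'.trans (hn.trans hbH)), false_or] at hcheck
  obtain ⟨σ, hσ, hcheck⟩ := of_force hcheck
  obtain ⟨v, hv, hcheck⟩ := of_force hcheck
  obtain ⟨R, hR, hcheck⟩ := of_force hcheck
  obtain ⟨v', hv', hcheck⟩ := of_force hcheck
  obtain ⟨tot, htot, hcheck⟩ := of_force hcheck
  obtain ⟨m, hm, hcheck⟩ := of_force hcheck
  obtain ⟨c, -, hcheck⟩ := of_force hcheck
  replace hσ : unscale σ ≤ sigma s₁ := hσ ▸ unscale_sigmaLower_le hs hs' hsL hsH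
  replace hv : unscale v ≤ wfun t h₁ / 2 := by
    rw [hv, natMax_eq]
    refine (unscale_cosLower_le _).trans ?_
    have h₁' := sub_le_unscale_sub qH sL
    have h₂' := sub_le_unscale_sub (aH + sH) qL
    simp only [unscale_add] at h₂'
    rw [unscale_max]
    have h₃ := le_max_left (unscale (qH - sL)) (unscale (aH + sH - qL))
    have h₄ := le_max_right (unscale (qH - sL)) (unscale (aH + sH - qL))
    exact le_half_wfun (abs_le.2 ⟨by linarith, by linarith⟩) (abs_le.2 ⟨by linarith, by linarith⟩)
  replace hv' : unscale v' ≤ wfun (t - h₁) h₂ / 2 := by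
    rw [hv', natMax_eq]
    refine (unscale_cosLower_le _).trans ?_
    have h₁' := sub_le_unscale_sub qH (sL + aL)
    simp only [unscale_add] at h₁'
    rw [unscale_max]
    have h₃ := le_max_left (unscale (qH - (sL + aL))) (unscale U)
    have h₄ := le_max_right (unscale (qH - (sL + aL))) (unscale U)
    exact le_half_wfun (abs_le.2 ⟨by linarith, by linarith⟩) (abs_le.2 ⟨by linarith, by linarith⟩)
  replace hR : unscale R ≤ Xfun t (t - h₁) h₂ + h₂ := by
    rw [hR, natMax_eq, natMax_eq]
    refine (unscale_cosLower_le _).trans (le_Xfun_add (by linarith) ?_ ?_ ?_)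
    · exact (half_le_unscale hbH).trans (unscale_mono (le_max_left _ _))
    · refine le_trans ?_ (unscale_mono ((le_max_left _ _).trans (le_max_right _ _)))
      have := sub_le_unscale_sub (bH + sH) qL
      simp only [unscale_add] at this
      linarith
    · refine le_trans ?_ (unscale_mono ((le_max_right _ _).trans (le_max_right _ _)))
      have := sub_le_unscale_sub (bH + qH) (aL + sL)
      simp only [unscale_add] at this
      linarith
  have hB : (tot : ℝ) / 10 ^ 8 ≤ s₁ ^ 2 + B4 t h₁ (wfun t h₁) h₂ + h₂ ^ 2 := by
    have hY := le_B4 (a := t) (h := h₁) (w := wfun t h₁) (hb0 : 0 ≤ h₂) le_rfl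
    have hsub := unscale_sub_le (v + R) (aH + bH)
    rw [unscale_add, unscale_add] at hsub
    have hg : unscale (v + R - (aH + bH)) ≤ max (Yfun t h₁ (wfun t h₁) h₂) 0 := by
      refine hsub.trans (max_le_max_right _ ?_)
      unfold Yfun
      linarith
    have hs2 := mul_self_le_mul_self (unscale_nonneg sL) hsL
    have ha2 := mul_self_le_mul_self (unscale_nonneg aL) haL
    have hb2 := mul_self_le_mul_self (unscale_nonneg bL) hbL
    have hm := mul_le_mul hbL hg (unscale_nonneg _) hb0
    have : (tot : ℝ) / 10 ^ 8 = unscale sL * unscale sL + unscale aL * unscale aL +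
        unscale bL * unscale bL + unscale bL * unscale (v + R - (aH + bH)) := by
      rw [htot]
      unfold unscale
      push_cast
      ring
    linarith
  have hpocket : ∀ {bonus lo hi : ℕ},
      pocketCheck tot qL sH aH bH u v' bonus lo hi = true → unscale lo ≤ sn → sn ≤ unscale hi →
      (bonus : ℝ) / 10 ^ 10 ≤ Efun s₁ sn → 8 / 5 < packedArea s₁ h₁ h₂ sn := by
    intro bonus lo hi hp hlo hhi hadd
    have := lt_of_pocketCheck hp hlo hhi (a := t - h₁) (by linarith) (by linarith) hv' hbH
    unfold packedArea
    linarith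
  simp only [Bool.and_eq_true] at hcheck
  obtain ⟨⟨hc₁, hc₂⟩, hc₃⟩ := hcheck
  rcases le_total sn (unscale σ) with h | h
  · refine hpocket hc₁ hz' ?_ ?_
    · rw [natMin_eq, unscale_min]
      exact le_min h (hn.trans hbH)
    · refine le_trans (le_of_eq ?_) (le_Efun (unscale_nonneg σ) hσ h)
      unfold unscale
      push_cast
      ring
  have hE : ((0 : ℕ) : ℝ) / 10 ^ 10 ≤ Efun s₁ sn := by simpa using Efun_nonneg s₁ sn
  rcases le_total sn (unscale c) with h' | h'
  · refine hpocket hc₂ ?_ h' hE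
    rw [hm, natMax_eq, unscale_max]
    exact max_le hz' h
  · exact hpocket hc₃ h' (hn.trans hbH) hE

theorem lt_packedArea_of_boxCheck {s₁ h₁ h₂ sn : ℝ} (hf : IsFeasible s₁ h₁ h₂ sn) (k : ℕ)
    {sL sH aL aH bL bH : ℕ} (hcheck : boxCheck k sL sH aL aH bL bH = true)
    (hsL : unscale sL ≤ s₁) (hsH : s₁ ≤ unscale sH) (haL : unscale aL ≤ h₁)
    (haH : h₁ ≤ unscale aH) (hbL : unscale bL ≤ h₂) (hbH : h₂ ≤ unscale bH) :
    8 / 5 < packedArea s₁ h₁ h₂ sn := by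
  induction k generalizing sL sH aL aH bL bH with
  | zero => cases hcheck
  | succ k ih =>
    simp only [boxCheck, force_eq, Bool.or_eq_true] at hcheck
    rcases hcheck with hcheck | hcheck
    · exact lt_packedArea_of_leafCheck hf hcheck hsL hsH haL haH hbL hbH
    simp only [cond_eq_ite] at hcheck
    split_ifs at hcheck <;> simp only [Bool.and_eq_true] at hcheck
    · rcases le_total s₁ (unscale ((sL + sH) / 2)) with h | h
      · exact ih hcheck.1 hsL h haL haH hbL hbH
      · exact ih hcheck.2 h hsH haL haH hbL hbH
    · rcases le_total h₁ (unscale ((aL + aH) / 2)) with h | h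
      · exact ih hcheck.1 hsL hsH haL h hbL hbH
      · exact ih hcheck.2 hsL hsH h haH hbL hbH
    · rcases le_total h₂ (unscale ((bL + bH) / 2)) with h | h
      · exact ih hcheck.1 hsL hsH haL haH hbL h
      · exact ih hcheck.2 hsL hsH haL haH h hbH

theorem boxCheck_eq_true : boxCheck 30 2950 12650 0 12650 0 12650 = true := by
  decide +kernel

theorem two_subcontainers (s₁ h₁ h₂ sn : ℝ)
    (hz0 : 0 < Tfun (-Tinv s₁ + h₁ + h₂)) (hzsn : Tfun (-Tinv s₁ + h₁ + h₂) < sn)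
    (hsn2 : sn ≤ h₂) (h21 : h₂ ≤ h₁) (h1s : h₁ ≤ s₁)
    (hs1lo : 0.295 ≤ s₁) (hs1hi : s₁ ≤ Real.sqrt (8 / 5))
    (hsum : h₁ + h₂ ≤ 1 + Tinv s₁) :
    s₁ ^ 2 + sn ^ 2 + Efun s₁ sn +
      B4 (Tinv s₁) h₁ (wfun (Tinv s₁) h₁) h₂ +
      B4 (Tinv s₁ - h₁) h₂ (wfun (Tinv s₁ - h₁) h₂) sn > 8 / 5 := by
  have hs : s₁ ≤ 1.265 := hs1hi.trans (Real.sqrt_le_iff.2 ⟨by norm_num, by norm_num⟩)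
  have hf : IsFeasible s₁ h₁ h₂ sn := ⟨hz0, hzsn, hsn2, h21, h1s, hs1lo, hs⟩
  have h0 : unscale 0 ≤ h₂ := by
    norm_num [unscale]
    linarith
  have hH : s₁ ≤ unscale 12650 := by
    norm_num [unscale] at hs ⊢
    exact hs
  have hL : unscale 2950 ≤ s₁ := by
    norm_num [unscale] at hs1lo ⊢
    exact hs1lo
  exact lt_packedArea_of_boxCheck hf 30 boxCheck_eq_true hL hH (h0.trans h21) (h1s.trans hH) h0
    (h21.trans (h1s.trans hH))
end
end

section
/- (Five Subcontainers, large last square) Let s₁, h₁, …, h₅, sₙ be reals, set h₆ := sₙ, z₅ := T(−T⁻¹(s₁) + h₁ + h₂ + h₃ + h₄ + h₅), and wᵢ := w(T⁻¹(s₁) − (h₁ + ⋯ + h_{i−1}), hᵢ) for 1 ≤ i ≤ 5, and suppose 0 < z₅ < sₙ, σ(s₁) < sₙ ≤ h₅ ≤ h₄ ≤ h₃ ≤ h₂ ≤ h₁ ≤ s₁, 0.295 ≤ s₁ ≤ √(8/5), and h₁ + h₂ + h₃ + h₄ + h₅ ≤ 1 + T⁻¹(s₁). Then F_{SC₅} :=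 s₁² + sₙ² + Σ_{i=1}^{5} B₄(T⁻¹(s₁) − (h₁ + ⋯ + h_{i−1}), hᵢ, wᵢ, h_{i+1}) > 8/5. -/
noncomputable section

lemma sq_le_B4 (a h w h' : ℝ) : h ^ 2 ≤ B4 a h w h' := by
  refine le_trans ?_ (le_max_right _ _)
  refine le_trans ?_ (le_max_right _ _)
  have : 0 ≤ min (max (Yfun a h w h') 0 ^ 2) (2 * h' ^ 2) := by positivity
  linarith

/-- In a wide subcontainer, `B₄` is bounded below by a quantity depending only on the width, the
height and a lower bound `t` for the height of the following subcontainer. -/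
lemma le_B4_of_wide {a h w h' t c : ℝ} (ht : 0 ≤ t) (hth' : t ≤ h') (hcw : c ≤ w)
    (hc : h + h' + t ≤ c) (hc2 : 2 * h ≤ c) : t * (c - t) + t * (h - t) ≤ B4 a h w h' := by
  have hB : h ^ 2 + (w - h - h') * h' ≤ B4 a h w h' := by
    refine le_trans ?_ (le_max_left _ _)
    rw [B2, if_neg (by linarith), if_neg (by linarith)]
    exact le_trans (le_max_left _ _) (le_max_right _ _)
  have h1 : 0 ≤ (h' - t) * (w - h - h' - t) := mul_nonneg (by linarith) (by linarith)
  have h2 : t * c ≤ t * w := mul_le_mul_of_nonneg_left hcw ht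
  nlinarith [sq_nonneg (h - t)]

lemma le_wfun {y h c m : ℝ} (hm : c ^ 2 ≤ 4 * (1 - m ^ 2)) (h1 : |y| ≤ m)
    (h2 : |y - h| ≤ m) : c ≤ wfun y h := by
  have e1 : y ^ 2 ≤ m ^ 2 := sq_le_sq' (by linarith [neg_abs_le y]) (by linarith [le_abs_self y])
  have e2 : (y - h) ^ 2 ≤ m ^ 2 :=
    sq_le_sq' (by linarith [neg_abs_le (y - h)]) (by linarith [le_abs_self (y - h)])
  have : c / 2 ≤ Real.sqrt (min (1 - y ^ 2) (1 - (y - h) ^ 2)) := by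
    apply Real.le_sqrt_of_sq_le
    rw [le_min_iff]
    constructor <;> nlinarith
  unfold wfun
  linarith

lemma Tinv_lower {s : ℝ} (hs : s ^ 2 ≤ 8 / 5) : 1 - s ^ 2 / 7 - s ≤ Tinv s := by
  have : 1 - s ^ 2 / 7 ≤ Real.sqrt (1 - s ^ 2 / 4) := by
    apply Real.le_sqrt_of_sq_le
    nlinarith [sq_nonneg s]
  unfold Tinv
  linarith

lemma Tinv_upper {s : ℝ} (hs : s ^ 2 ≤ 8 / 5) : Tinv s ≤ 1 - s ^ 2 / 8 - s := by
  have : Real.sqrt (1 - s ^ 2 / 4) ≤ 1 - s ^ 2 / 8 := by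
    rw [Real.sqrt_le_iff]
    constructor <;> nlinarith [sq_nonneg (s ^ 2)]
  unfold Tinv
  linarith

lemma Tinv_lt_of_Tfun_lt {t u : ℝ} (ht0 : 0 ≤ t) (ht1 : t ≤ 1) (h : Tfun u < t) :
    Tinv t < u := by
  by_contra! hc
  unfold Tinv at hc
  unfold Tfun at h
  have hr := Real.sqrt_nonneg (1 - t ^ 2 / 4)
  have hr2 := Real.sq_sqrt (show (0 : ℝ) ≤ 1 - t ^ 2 / 4 by nlinarith)
  set r := Real.sqrt (1 - t ^ 2 / 4)
  have hs := Real.sqrt_nonneg (5 - u ^ 2)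
  rcases le_or_gt (2 * u + 5 / 2 * t) 0 with h0 | h0
  · linarith
  · have hut : (u + t) ^ 2 ≤ r ^ 2 := by
      have : t / 4 ≤ r := by
        apply Real.le_sqrt_of_sq_le
        nlinarith
      exact sq_le_sq' (by linarith) (by linarith)
    have : 2 * u + 5 / 2 * t ≤ Real.sqrt (5 - u ^ 2) := by
      apply Real.le_sqrt_of_sq_le
      nlinarith
    linarith

/-- If five subcontainers fit although their last square exceeds `σ(s₁)`, then `s₁` is small. -/
lemma lt_of_five_mul_sigma_lt {s : ℝ} (hs0 : 0 < s) (hs : s ^ 2 ≤ 8 / 5)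
    (h : 5 * sigma s < 1 + Tinv s) : s < 0.44 := by
  by_contra! hc
  have hlow := Tinv_lower hs
  have hupp := Tinv_upper hs
  have hs2 : s < 1.265 := by nlinarith
  unfold sigma at h
  split_ifs at h with hst
  · have hr2 := Real.sq_sqrt (show (0 : ℝ) ≤ 1 - s ^ 2 / 4 by nlinarith)
    have hr : Tinv s = Real.sqrt (1 - s ^ 2 / 4) - s := rfl
    have key : 4 + 5 * s + 14 * Tinv s ≤ 5 * Real.sqrt (8 - (s - 2 * Tinv s) ^ 2) := by
      have : (4 + 5 * s + 14 * Tinv s) / 5 ≤ Real.sqrt (8 - (s - 2 * Tinv s) ^ 2) := by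
        apply Real.le_sqrt_of_sq_le
        rw [hr] at hlow ⊢
        set r := Real.sqrt (1 - s ^ 2 / 4)
        have h1 : (1 - s ^ 2 / 7) * (552 * s - 112) ≤ r * (552 * s - 112) :=
          mul_le_mul_of_nonneg_right (by linarith) (by linarith)
        have h2 : 0 ≤ -112 - 232 * s ^ 2 + 72 * s + (1 - s ^ 2 / 7) * (552 * s - 112) := by
          nlinarith [mul_nonneg (sub_nonneg.2 hc) (sub_nonneg.2 hs2.le),
            mul_nonneg (mul_nonneg (sub_nonneg.2 hc) (sub_nonneg.2 hs2.le)) hs0.le]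
        nlinarith
      linarith
    linarith
  · have : 4.2 ≤ Real.sqrt (20 - s ^ 2) := by
      apply Real.le_sqrt_of_sq_le
      nlinarith
    nlinarith

lemma le_sigma {a s τ : ℝ} (ha : 0 < a) (has : a ≤ s) (hs1 : s ≤ 0.44) (hτ : 0 ≤ τ)
    (h : 16 * τ ^ 2 + 8 * τ * (2 - a - a ^ 2 / 4) + 2 * a ^ 2 + 8 * (1 - a - a ^ 2 / 8) ^ 2 ≤ 8) :
    τ ≤ sigma s := by
  have hs0 : 0 < s := by linarith
  have hsq : a ^ 2 ≤ s ^ 2 := by nlinarith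
  replace h : 16 * τ ^ 2 + 8 * τ * (2 - s - s ^ 2 / 4) + 2 * s ^ 2
      + 8 * (1 - s - s ^ 2 / 8) ^ 2 ≤ 8 := by
    have h1 : τ * (2 - s - s ^ 2 / 4) ≤ τ * (2 - a - a ^ 2 / 4) :=
      mul_le_mul_of_nonneg_left (by linarith) hτ
    have h2 : 1 - s - s ^ 2 / 8 ≤ 1 - a - a ^ 2 / 8 - (s - a) := by linarith
    have h3 : 0.5 ≤ 1 - s - s ^ 2 / 8 := by nlinarith
    have h4 : (1 - s - s ^ 2 / 8) ^ 2 + (s - a) ≤ (1 - a - a ^ 2 / 8) ^ 2 := by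
      nlinarith [mul_nonneg (sub_nonneg.2 h2) (sub_nonneg.2 h3)]
    nlinarith
  have hs : s ^ 2 ≤ 8 / 5 := by nlinarith
  have hlow := Tinv_lower hs
  have hupp := Tinv_upper hs
  have hpos : 0 ≤ Tinv s := by nlinarith
  have hst : s ≤ s1star := by
    apply Real.le_sqrt_of_sq_le
    nlinarith [Real.sqrt_nonneg 2]
  rw [sigma, if_pos hst]
  have : 4 * τ + s + 2 * Tinv s ≤ Real.sqrt (8 - (s - 2 * Tinv s) ^ 2) := by
    apply Real.le_sqrt_of_sq_le
    have h1 : Tinv s ^ 2 ≤ (1 - s - s ^ 2 / 8) ^ 2 := sq_le_sq' (by linarith) (by linarith)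
    have h2 : τ * Tinv s ≤ τ * (1 - s - s ^ 2 / 8) := mul_le_mul_of_nonneg_left (by linarith) hτ
    nlinarith
  linarith

/-- The area bound when `s₁` lies in a short interval `[a, b]`: here `[p, q]` encloses `T⁻¹(s₁)`,
`τ` bounds `σ(s₁)` from below, `mᵢ` bounds the distance of the `i`-th subcontainer's boundaries from
the center, and `cᵢ` bounds its width from below. -/
lemma area_bound_of_enclosure {a b p q τ m₁ m₂ m₃ m₄ c₁ c₂ c₃ c₄ s₁ h₁ h₂ h₃ h₄ h₅ sn : ℝ}
    (ha : 0 < a) (has : a ≤ s₁) (hsb : s₁ ≤ b) (hb : b ≤ 0.44) (hτ0 : 0 ≤ τ) (hq0 : q ≤ 0.7)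
    (hp : p ≤ 1 - b ^ 2 / 7 - b) (hq : 1 - a ^ 2 / 8 - a ≤ q)
    (hτ : 16 * τ ^ 2 + 8 * τ * (2 - a - a ^ 2 / 4) + 2 * a ^ 2 + 8 * (1 - a - a ^ 2 / 8) ^ 2 ≤ 8)
    (hm₁ : q ≤ m₁ ∧ -m₁ ≤ p - b)
    (hm₂ : q - τ ≤ m₂ ∧ (-m₂ ≤ p - 2 * b ∨ -m₂ ≤ -1 + 3 * τ))
    (hm₃ : q - 2 * τ ≤ m₃ ∧ (-m₃ ≤ p - 3 * b ∨ -m₃ ≤ -1 + 2 * τ))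
    (hm₄ : q - 3 * τ ≤ m₄ ∧ (-m₄ ≤ p - 4 * b ∨ -m₄ ≤ -1 + τ))
    (hc₁ : 3 * b ≤ c₁ ∧ c₁ ^ 2 ≤ 4 * (1 - m₁ ^ 2)) (hc₂ : 3 * b ≤ c₂ ∧ c₂ ^ 2 ≤ 4 * (1 - m₂ ^ 2))
    (hc₃ : 3 * b ≤ c₃ ∧ c₃ ^ 2 ≤ 4 * (1 - m₃ ^ 2)) (hc₄ : 3 * b ≤ c₄ ∧ c₄ ^ 2 ≤ 4 * (1 - m₄ ^ 2))
    (hF : 8 / 5 < a ^ 2 - 8 * τ ^ 2 + τ * (c₁ + c₂ + c₃ + c₄ + p + 0.985))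
    (hK : 5.44 ≤ c₁ + c₂ + c₃ + c₄ + p + 0.985)
    (hz : Tfun (-Tinv s₁ + h₁ + h₂ + h₃ + h₄ + h₅) < sn) (hσ : sigma s₁ < sn)
    (hsn5 : sn ≤ h₅) (h54 : h₅ ≤ h₄) (h43 : h₄ ≤ h₃) (h32 : h₃ ≤ h₂) (h21 : h₂ ≤ h₁)
    (h1s : h₁ ≤ s₁) (hsum : h₁ + h₂ + h₃ + h₄ + h₅ ≤ 1 + Tinv s₁) :
    8 / 5 < s₁ ^ 2 + sn ^ 2 +
      (B4 (Tinv s₁) h₁ (wfun (Tinv s₁) h₁) h₂ +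
       B4 (Tinv s₁ - h₁) h₂ (wfun (Tinv s₁ - h₁) h₂) h₃ +
       B4 (Tinv s₁ - h₁ - h₂) h₃ (wfun (Tinv s₁ - h₁ - h₂) h₃) h₄ +
       B4 (Tinv s₁ - h₁ - h₂ - h₃) h₄ (wfun (Tinv s₁ - h₁ - h₂ - h₃) h₄) h₅ +
       B4 (Tinv s₁ - h₁ - h₂ - h₃ - h₄) h₅ (wfun (Tinv s₁ - h₁ - h₂ - h₃ - h₄) h₅) sn) := by
  have hs0 : 0 < s₁ := by linarith
  have hb2 : s₁ ^ 2 ≤ b ^ 2 := pow_le_pow_left₀ hs0.le hsb 2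
  have ha2 : a ^ 2 ≤ s₁ ^ 2 := pow_le_pow_left₀ ha.le has 2
  have hs : s₁ ^ 2 ≤ 8 / 5 := by
    have := pow_le_pow_left₀ hs0.le (hsb.trans hb) 2
    norm_num at this ⊢
    linarith
  have hpy : p ≤ Tinv s₁ := by linarith [Tinv_lower hs]
  have hyq : Tinv s₁ ≤ q := by linarith [Tinv_upper hs]
  have hτsn : τ ≤ sn := (le_sigma ha has (hsb.trans hb) hτ0 hτ).trans hσ.le
  have hsn : sn ≤ 0.34 := by linarith
  have hu := Tinv_lt_of_Tfun_lt (by linarith) (by linarith) hz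
  have hTsn : 0.985 - sn ≤ Tinv sn := by
    have : 0.985 ≤ Real.sqrt (1 - sn ^ 2 / 4) := by
      apply Real.le_sqrt_of_sq_le
      have := pow_le_pow_left₀ (by linarith) hsn 2
      norm_num at this ⊢
      linarith
    unfold Tinv
    linarith
  generalize Tinv s₁ = y at *
  have w₁ : c₁ ≤ wfun y h₁ := by
    refine le_wfun hc₁.2 ?_ ?_ <;> rw [abs_le] <;> constructor <;>
      linarith [hm₁.1, hm₁.2]
  have w₂ : c₂ ≤ wfun (y - h₁) h₂ := by
    obtain ⟨hu₂, hl₂ | hl₂⟩ := hm₂ <;>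
      refine le_wfun hc₂.2 ?_ ?_ <;> rw [abs_le] <;> constructor <;> linarith
  have w₃ : c₃ ≤ wfun (y - h₁ - h₂) h₃ := by
    obtain ⟨hu₂, hl₂ | hl₂⟩ := hm₃ <;>
      refine le_wfun hc₃.2 ?_ ?_ <;> rw [abs_le] <;> constructor <;> linarith
  have w₄ : c₄ ≤ wfun (y - h₁ - h₂ - h₃) h₄ := by
    obtain ⟨hu₂, hl₂ | hl₂⟩ := hm₄ <;>
      refine le_wfun hc₄.2 ?_ ?_ <;> rw [abs_le] <;> constructor <;> linarith
  have ht : 0 ≤ sn := by linarith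
  have b₁ := le_B4_of_wide (a := y) (h := h₁) (h' := h₂) ht (by linarith) w₁ (by linarith) (by linarith)
  have b₂ := le_B4_of_wide (a := y - h₁) (h := h₂) (h' := h₃) ht (by linarith) w₂ (by linarith) (by linarith)
  have b₃ := le_B4_of_wide (a := y - h₁ - h₂) (h := h₃) (h' := h₄) ht (by linarith) w₃ (by linarith) (by linarith)
  have b₄ := le_B4_of_wide (a := y - h₁ - h₂ - h₃) (h := h₄) (h' := h₅) ht (by linarith) w₄
    (by linarith) (by linarith)
  have b₅ := sq_le_B4 (y - h₁ - h₂ - h₃ - h₄) h₅ (wfun (y - h₁ - h₂ - h₃ - h₄) h₅) sn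
  have hS : sn * (p + 0.985 - sn) ≤ sn * (h₁ + h₂ + h₃ + h₄ + h₅) :=
    mul_le_mul_of_nonneg_left (by linarith) ht
  have hG : 0 ≤ (sn - τ) * (c₁ + c₂ + c₃ + c₄ + p + 0.985 - 8 * (sn + τ)) :=
    mul_nonneg (by linarith) (by linarith)
  linarith [mul_nonneg (ht.trans hsn5) (sub_nonneg.2 hsn5)]

theorem five_subcontainers_large_last (s₁ h₁ h₂ h₃ h₄ h₅ sn : ℝ)
    (hz0 : 0 < Tfun (-Tinv s₁ + h₁ + h₂ + h₃ + h₄ + h₅))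
    (hzsn : Tfun (-Tinv s₁ + h₁ + h₂ + h₃ + h₄ + h₅) < sn)
    (hσ : sigma s₁ < sn)
    (hsn5 : sn ≤ h₅) (h54 : h₅ ≤ h₄) (h43 : h₄ ≤ h₃) (h32 : h₃ ≤ h₂)
    (h21 : h₂ ≤ h₁) (h1s : h₁ ≤ s₁)
    (hs1lo : 0.295 ≤ s₁) (hs1hi : s₁ ≤ Real.sqrt (8 / 5))
    (hsum : h₁ + h₂ + h₃ + h₄ + h₅ ≤ 1 + Tinv s₁) :
    s₁ ^ 2 + sn ^ 2 +
      (B4 (Tinv s₁) h₁ (wfun (Tinv s₁) h₁) h₂ +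
       B4 (Tinv s₁ - h₁) h₂ (wfun (Tinv s₁ - h₁) h₂) h₃ +
       B4 (Tinv s₁ - h₁ - h₂) h₃ (wfun (Tinv s₁ - h₁ - h₂) h₃) h₄ +
       B4 (Tinv s₁ - h₁ - h₂ - h₃) h₄ (wfun (Tinv s₁ - h₁ - h₂ - h₃) h₄) h₅ +
       B4 (Tinv s₁ - h₁ - h₂ - h₃ - h₄) h₅ (wfun (Tinv s₁ - h₁ - h₂ - h₃ - h₄) h₅) sn)
      > 8 / 5 := by
  have hs0 : 0 < s₁ := by linarith
  have hs : s₁ ^ 2 ≤ 8 / 5 := (Real.le_sqrt hs0.le (by norm_num)).1 hs1hi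
  have hlt : s₁ < 0.44 := lt_of_five_mul_sigma_lt hs0 hs (by linarith)
  rw [gt_iff_lt]
  rcases le_or_gt s₁ 0.31 with H₁ | H₁
  · exact area_bound_of_enclosure (a := 0.295) (b := 0.31) (p := 0.676) (q := 0.695) (τ := 0.231)
      (m₁ := 0.695) (m₂ := 0.464) (m₃ := 0.254) (m₄ := 0.564)
      (c₁ := 1.438) (c₂ := 1.771) (c₃ := 1.934) (c₄ := 1.651)
      (by norm_num) hs1lo H₁ (by norm_num) (by norm_num) (by norm_num) (by norm_num)
      (by norm_num) (by norm_num) (by norm_num) (by norm_num) (by norm_num) (by norm_num)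
      (by norm_num) (by norm_num) (by norm_num) (by norm_num) (by norm_num) (by norm_num)
      hzsn hσ hsn5 h54 h43 h32 h21 h1s hsum
  rcases le_or_gt s₁ 0.325 with H₂ | H₂
  · exact area_bound_of_enclosure (a := 0.31) (b := 0.325) (p := 0.659) (q := 0.678) (τ := 0.24)
      (m₁ := 0.678) (m₂ := 0.439) (m₃ := 0.317) (m₄ := 0.641)
      (c₁ := 1.47) (c₂ := 1.796) (c₃ := 1.896) (c₄ := 1.535)
      (by norm_num) H₁.le H₂ (by norm_num) (by norm_num) (by norm_num) (by norm_num)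
      (by norm_num) (by norm_num) (by norm_num) (by norm_num) (by norm_num) (by norm_num)
      (by norm_num) (by norm_num) (by norm_num) (by norm_num) (by norm_num) (by norm_num)
      hzsn hσ hsn5 h54 h43 h32 h21 h1s hsum
  rcases le_or_gt s₁ 0.35 with H₃ | H₃
  · exact area_bound_of_enclosure (a := 0.325) (b := 0.35) (p := 0.632) (q := 0.662) (τ := 0.249)
      (m₁ := 0.662) (m₂ := 0.414) (m₃ := 0.418) (m₄ := 0.751)
      (c₁ := 1.499) (c₂ := 1.82) (c₃ := 1.816) (c₄ := 1.32)
      (by norm_num) H₂.le H₃ (by norm_num) (by norm_num) (by norm_num) (by norm_num)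
      (by norm_num) (by norm_num) (by norm_num) (by norm_num) (by norm_num) (by norm_num)
      (by norm_num) (by norm_num) (by norm_num) (by norm_num) (by norm_num) (by norm_num)
      hzsn hσ hsn5 h54 h43 h32 h21 h1s hsum
  exact area_bound_of_enclosure (a := 0.35) (b := 0.44) (p := 0.532) (q := 0.635) (τ := 0.263)
    (m₁ := 0.635) (m₂ := 0.372) (m₃ := 0.474) (m₄ := 0.737)
    (c₁ := 1.545) (c₂ := 1.856) (c₃ := 1.761) (c₄ := 1.351)
    (by norm_num) H₃.le hlt.le (by norm_num) (by norm_num) (by norm_num) (by norm_num)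
    (by norm_num) (by norm_num) (by norm_num) (by norm_num) (by norm_num) (by norm_num)
    (by norm_num) (by norm_num) (by norm_num) (by norm_num) (by norm_num) (by norm_num)
    hzsn hσ hsn5 h54 h43 h32 h21 h1s hsum
end
end

section
/- (Many Subcontainers, third subcontainer reaching below the center) Let s₁, h₁, h₂, h₃, h₄ be reals with s₁ ≥ h₁ ≥ h₂ ≥ h₃ ≥ h₄ > 0 and 0.295 ≤ s₁ ≤ √(8/5). Set H₄ := 1 + T⁻¹(s₁) − h₁ − h₂ − h₃, h₅ := h₄ in the role of the next square, and wᵢ := w(T⁻¹(s₁) − (h₁ + ⋯ + h_{i−1}), hᵢ) for 1 ≤ i ≤ 3, and suppose 0 ≤ H₄ ≤ 1 and h₄ ≤ H₄. Then F_{MSC₁} := s₁² + 0.83·σ(s₁)² + B₅(h₄, H₄) + Σ_{i=1}^{3} B₄(T⁻¹(s₁) − (h₁ + ⋯ + h_{i−1}), hᵢ, wᵢ, h_{i+1}) > 8/5. -/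
noncomputable section

namespace BranchAndBound

/-! ### A branch and bound search in fixed-point arithmetic

Lengths are represented by natural numbers in units of `1 / 4096`, areas in units of
`1 / (12 * 4096 ^ 2)`. The search is run by the kernel, so it is written with the
primitive operations on `Nat` and with `force`, which makes the kernel evaluate an argument
before substituting it. -/

local infixl:65 "⊹" => Nat.add
local infixl:65 "∸" => Nat.sub
local infixl:70 "⋆" => Nat.mul
local infixl:70 "÷" => Nat.div
local infix:50 "≼" => Nat.ble

/-- `k x`, where `x` is evaluated to a numeral first. -/
def force (x : ℕ) (k : ℕ → Bool) : Bool := Nat.rec (k 0) (fun n _ => k n.succ) x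

def ite' {α : Type} (c : Bool) (x y : α) : α := Bool.rec y x c

def or' (c d : Bool) : Bool := Bool.rec d true c

def and' (c d : Bool) : Bool := Bool.rec false d c

def max' (a b : ℕ) : ℕ := a ⊹ (b ∸ a)

def min' (a b : ℕ) : ℕ := a ∸ (a ∸ b)

/-- An upper bound for `√n`, by one step of Heron's method from `r > 0`. -/
def heron (n r : ℕ) : ℕ := ((r ⊹ n ÷ r) ÷ 2).succ

/-- A lower bound for `√n`. -/
def sqrtLo (n : ℕ) : ℕ := n ÷ heron n (n ÷ 5500 ⊹ 1280)

/-- A lower bound for half the width of the disk between two heights in `[l, u]`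
above its lowest point. -/
def widthLo (l u : ℕ) : ℕ := sqrtLo (min' (l ⋆ (8192 ∸ l)) (u ⋆ (8192 ∸ u)))

/-- A lower bound for `B2`, for half-widths at least `w`. -/
def b2Lo (hl hu w kl ku : ℕ) : ℕ :=
  ite' (hu ≼ w)
    (max' (3 ⋆ hl ⋆ (4 ⋆ w ⊹ hl)) (max' (6 ⋆ hl ⋆ (2 ⋆ w ⊹ hl) ∸ 12 ⋆ ku ⋆ ku)
      (12 ⋆ (hl ⋆ hl ⊹ min' (2 ⋆ w ⋆ kl ∸ (hl ⊹ kl) ⋆ kl) (2 ⋆ w ⋆ ku ∸ (hl ⊹ ku) ⋆ ku)))))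
    (12 ⋆ hl ⋆ hl)

/-- A lower bound for `Yfun`, for half-widths at least `w`. -/
def yLo (w p q al au bu : ℕ) : ℕ :=
  w ⊹ sqrtLo (16777216 ∸
      max' (bu.succ ÷ 2) (max' (bu ⊹ 4096 ∸ p) (bu ⊹ q ∸ (4096 ⊹ al))) ⋆
      max' (bu.succ ÷ 2) (max' (bu ⊹ 4096 ∸ p) (bu ⊹ q ∸ (4096 ⊹ al)))) ∸ (au ⊹ bu)

/-- A lower bound for `B3`, for values of `Yfun` at least `y`. -/
def b3Lo (al bl y : ℕ) : ℕ := 12 ⋆ (al ⋆ al ⊹ max' (y ⋆ bl) (min' (y ⋆ y) (2 ⋆ bl ⋆ bl)))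

/-- The area bound, apart from the contributions of the first subcontainer and the negative
part of `B5`. -/
def restLo (K p q al au bl bu cl cu dl du e g : ℕ) : ℕ :=
  K ⊹ b2Lo bl bu (widthLo (p ∸ au ∸ bu) (q ∸ al)) cl cu
    ⊹ b2Lo cl cu (widthLo (p ∸ au ∸ bu ∸ cu) (q ∸ al ∸ bl)) dl du
    ⊹ e ⋆ (16 ⋆ g ∸ 12 ⋆ du)

def enough (p q al au bl bu w r t : ℕ) : Bool :=
  or' (t ≼ r ⊹ b2Lo al au w bl bu) (t ≼ r ⊹ b3Lo al bl (yLo w p q al au bu))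

def evalBox (K p q al au bl bu cl cu dl du e g : ℕ) : Bool :=
  force (widthLo (p ∸ au) q) fun w => force (restLo K p q al au bl bu cl cu dl du e g) fun r =>
    enough p q al au bl bu w r
      (322122548 ⊹ (q ∸ (al ⊹ bl ⊹ cl ⊹ dl)) ⋆ (12 ⋆ du ∸ 16 ⋆ g))

/-- The box contains no admissible point, or the area bound holds on the whole box. -/
def testBox (K p q al au bl bu cl cu dl du : ℕ) : Bool :=
  or' (q.succ ≼ al ⊹ bl ⊹ cl ⊹ dl) (force (p ∸ (au ⊹ bu ⊹ cu ⊹ du)) fun e =>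
    force (sqrtLo (e ⋆ (8192 ∸ e))) (evalBox K p q al au bl bu cl cu dl du e))

/-- Bisect the side of largest weight. -/
def bisect (f : ℕ → ℕ → ℕ → ℕ → ℕ → ℕ → ℕ → ℕ → Bool) (al au bl bu cl cu dl du va vb vc vd : ℕ) :
    Bool :=
  ite' (max' vb (max' vc vd) ≼ va)
    (force ((al ⊹ au) ÷ 2) fun m => and' (f al m bl bu cl cu dl du) (f m au bl bu cl cu dl du))
  (ite' (max' vc vd ≼ vb)
    (force ((bl ⊹ bu) ÷ 2) fun m => and' (f al au bl m cl cu dl du) (f al au m bu cl cu dl du))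
  (ite' (vd ≼ vc)
    (force ((cl ⊹ cu) ÷ 2) fun m => and' (f al au bl bu cl m dl du) (f al au bl bu m cu dl du))
    (force ((dl ⊹ du) ÷ 2) fun m => and' (f al au bl bu cl cu dl m) (f al au bl bu cl cu m du))))

def step (K p q : ℕ) (f : ℕ → ℕ → ℕ → ℕ → ℕ → ℕ → ℕ → ℕ → Bool)
    (al au bl bu cl cu dl du : ℕ) : Bool :=
  or' (testBox K p q al au bl bu cl cu dl du)
    (bisect f al au bl bu cl cu dl du
      (16 ⋆ (au ∸ al)) (14 ⋆ (bu ∸ bl)) (13 ⋆ (cu ∸ cl)) (7 ⋆ (du ∸ dl)))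

/-- The search of depth `n`; boxes are shrunk according to `d ≤ c ≤ b ≤ a`. -/
def search (n K p q : ℕ) : (al au bl bu cl cu dl du : ℕ) → Bool :=
  Nat.rec (fun _ _ _ _ _ _ _ _ => false) (fun _ f al au bl bu cl cu dl du =>
    force (max' cl dl) fun cl => force (max' bl cl) fun bl => force (max' al bl) fun al =>
    force (min' bu au) fun bu => force (min' cu bu) fun cu => force (min' du cu) fun du =>
      step K p q f al au bl bu cl cu dl du) n

/-- An upper bound for `4096 * √(1 - s ^ 2 / 4)`, at `s = i / 64`. -/
def halfHi (i : ℕ) : ℕ := heron (16777216 ∸ 1024 ⋆ i ⋆ i) (heron (16777216 ∸ 1024 ⋆ i ⋆ i) 4096)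

/-- A lower bound for `4096 * √(1 - s ^ 2 / 4)`, at `s = i / 64`. -/
def halfLo (i : ℕ) : ℕ := (16777216 ∸ 1024 ⋆ i ⋆ i) ÷ halfHi i

/-- A candidate for a lower bound of `4096 * sigma` on `[i / 64, (i + 1) / 64]`; see `sigmaTest`. -/
def sigmaLo (i : ℕ) : ℕ :=
  ite' (64 ≼ i) 1433
    (1840 ∸ 11 ⋆ max' (3953 ∸ 64 ⋆ i) (64 ⋆ i.succ ∸ 3953) ⋆
      max' (3953 ∸ 64 ⋆ i) (64 ⋆ i.succ ∸ 3953) ÷ 81920)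

/-- A test for `r / 4096 ≤ sigma (j / 64)`. -/
def sigmaTest (r j : ℕ) : Bool :=
  and' (r ≼ 64 ⋆ j)
    (4096 ⋆ j ⋆ j ⊹ 2 ⋆ r ⋆ r ≼ 2 ⋆ halfLo j ⋆ (64 ⋆ j ∸ r) ⊹ r ⋆ (64 ⋆ j))

/-- A test for the area bound for `s₁ ∈ [i / 64, (i + 1) / 64]`. -/
def cellTest (i : ℕ) : Bool :=
  force (sigmaLo i) fun r => force (4096 ⊹ halfLo i.succ ∸ 64 ⋆ i.succ) fun p =>
  force (4096 ⊹ halfHi i ∸ 64 ⋆ i) fun q => force (64 ⋆ i.succ) fun U =>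
    and' (and' (sigmaTest r i) (sigmaTest r i.succ))
      (search 30 (49152 ⋆ i ⋆ i ⊹ 249 ⋆ r ⋆ r ÷ 25) p q 0 U 0 U 0 U 0 U)

/-- `cellTest` holds at `i, …, i + n - 1`. -/
def cellsTest (i n : ℕ) : Bool :=
  Nat.rec true (fun j b => and' (cellTest (i ⊹ j)) b) n

lemma force_eq (x : ℕ) (k : ℕ → Bool) : force x k = k x := by cases x <;> rfl

lemma ite'_eq {α : Type} (c : Bool) (x y : α) : ite' c x y = if c = true then x else y := by
  cases c <;> rfl

lemma or'_eq (c d : Bool) : or' c d = (c || d) := by cases c <;> rfl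

lemma and'_eq (c d : Bool) : and' c d = (c && d) := by cases c <;> rfl

lemma max'_eq (a b : ℕ) : max' a b = max a b := by
  simp only [max', Nat.add_eq, Nat.sub_eq]; omega

lemma min'_eq (a b : ℕ) : min' a b = min a b := by
  simp only [min', Nat.sub_eq]; omega

lemma cast_sub_le {a b : ℕ} {x : ℝ} (hx : 0 ≤ x) (h : (a : ℝ) ≤ x + b) :
    ((a - b : ℕ) : ℝ) ≤ x := by
  rcases le_total b a with hab | hab
  · rw [Nat.cast_sub hab]; linarith
  · simpa [Nat.sub_eq_zero_of_le hab] using hx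

lemma le_cast_sub {a b : ℕ} {x : ℝ} (h : x + b ≤ a) : x ≤ ((a - b : ℕ) : ℝ) := by
  have : (a : ℝ) ≤ ((a - b : ℕ) : ℝ) + b := by exact_mod_cast le_tsub_add
  linarith

lemma cast_div_le' {a b : ℕ} {x : ℝ} (hb : 0 < b) (h : (a : ℝ) ≤ b * x) :
    ((a / b : ℕ) : ℝ) ≤ x := by
  refine Nat.cast_div_le.trans ?_
  rw [div_le_iff₀ (by exact_mod_cast hb)]
  linarith

lemma le_heron_sq {n r : ℕ} (hr : 0 < r) : n ≤ heron n r ^ 2 := by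
  change n ≤ ((r + n / r) / 2 + 1) ^ 2
  have h1 : n < r * (n / r + 1) := Nat.lt_mul_div_succ n hr
  generalize n / r = m at *
  have h2 : r + m + 1 ≤ 2 * ((r + m) / 2 + 1) := by omega
  generalize (r + m) / 2 + 1 = t at *
  zify at *
  nlinarith [sq_nonneg ((r : ℤ) - m - 1)]

lemma sqrt_le_heron {n r : ℕ} {x : ℝ} (hr : 0 < r) (h : x ≤ n) : √x ≤ heron n r := by
  refine Real.sqrt_le_iff.2 ⟨by positivity, h.trans ?_⟩
  exact_mod_cast le_heron_sq hr

lemma cast_div_heron_le {n r : ℕ} {x : ℝ} (hr : 0 < r) (h : (n : ℝ) ≤ x) :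
    ((n / heron n r : ℕ) : ℝ) ≤ √x := by
  refine le_trans (cast_div_le' (Nat.succ_pos _) ?_) (Real.sqrt_le_sqrt h)
  calc (n : ℝ) = √n * √n := (Real.mul_self_sqrt (by positivity)).symm
    _ ≤ _ := by gcongr; exact sqrt_le_heron hr le_rfl

lemma sqrtLo_le {n : ℕ} {x : ℝ} (h : (n : ℝ) ≤ x) : (sqrtLo n : ℝ) ≤ √x :=
  cast_div_heron_le (Nat.succ_pos _) h

lemma mul_sqrt_eq {c x : ℝ} (hc : 0 ≤ c) : c * √x = √(c ^ 2 * x) := by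
  rw [Real.sqrt_mul (sq_nonneg c), Real.sqrt_sq hc]

lemma min_mul_sub_le {l u : ℕ} {t : ℝ} (hl : (l : ℝ) ≤ t) (hu : t ≤ u) (ht : t ≤ 8192) :
    ((min (l * (8192 - l)) (u * (8192 - u)) : ℕ) : ℝ) ≤ t * (8192 - t) := by
  have hl0 : (0 : ℝ) ≤ l := by positivity
  rcases le_total u 8192 with h | h
  · have hl' : l ≤ 8192 := by exact_mod_cast hl.trans ht
    push_cast [Nat.cast_sub h, Nat.cast_sub hl']
    rcases le_total (4096 : ℝ) t with h4 | h4
    · exact (min_le_right _ _).trans (by nlinarith)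
    · exact (min_le_left _ _).trans (by nlinarith)
  · rw [Nat.sub_eq_zero_of_le h]
    simp only [mul_zero, Nat.zero_le, min_eq_right, Nat.cast_zero]
    nlinarith

lemma widthLo_le {l u : ℕ} {y h : ℝ} (hh : 0 ≤ h) (hy : y ≤ 1) (hl : (l : ℝ) ≤ 4096 * (1 + y - h))
    (hu : 4096 * (1 + y) ≤ u) : (widthLo l u : ℝ) ≤ 4096 * (wfun y h / 2) := by
  rw [wfun, mul_div_cancel_left₀ _ two_ne_zero, mul_sqrt_eq (by norm_num)]
  apply sqrtLo_le
  simp only [min'_eq, Nat.sub_eq, Nat.mul_eq]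
  rw [mul_min_of_nonneg _ _ (by norm_num)]
  refine le_min ((min_mul_sub_le (t := 4096 * (1 + y)) ?_ hu ?_).trans (le_of_eq ?_))
    ((min_mul_sub_le (t := 4096 * (1 + y - h)) hl ?_ ?_).trans (le_of_eq ?_)) <;> linarith

lemma sq_le_B1 {h w h' : ℝ} (hh : 0 ≤ h) (hw : 2 * h ≤ w) : h ^ 2 ≤ B1 h w h' :=
  le_max_of_le_left (by nlinarith)

lemma sq_le_B2 {h w h' : ℝ} (hh : 0 ≤ h) : h ^ 2 ≤ B2 h w h' := by
  unfold B2
  split_ifs with h1 h2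
  · rfl
  · nlinarith
  · exact sq_le_B1 hh (by linarith)

lemma b2Lo_le {hl hu w kl ku : ℕ} {h W k : ℝ} (hhl : (hl : ℝ) ≤ 4096 * h) (hhu : 4096 * h ≤ hu)
    (hw : (w : ℝ) ≤ 4096 * (W / 2)) (hkl : (kl : ℝ) ≤ 4096 * k) (hku : 4096 * k ≤ ku)
    (hk : k ≤ h) : (b2Lo hl hu w kl ku : ℝ) ≤ 12 * 4096 ^ 2 * B2 h W k := by
  have hl0 : (0 : ℝ) ≤ hl := by positivity
  have kl0 : (0 : ℝ) ≤ kl := by positivity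
  have w0 : (0 : ℝ) ≤ w := by positivity
  simp only [b2Lo, ite'_eq, max'_eq, min'_eq, Nat.sub_eq, Nat.mul_eq, Nat.add_eq, Nat.ble_eq]
  split_ifs with hc
  · have hc' : (hu : ℝ) ≤ w := by exact_mod_cast hc
    have hB : B2 h W k = B1 h W k := by
      rw [B2, if_neg (by linarith), if_neg (by linarith)]
    have h1 : 12 * 4096 ^ 2 * (h * W / 2 + h ^ 2 / 4) ≤ 12 * 4096 ^ 2 * B1 h W k := by
      gcongr; exact le_max_left _ _
    have h2 : 12 * 4096 ^ 2 * (h ^ 2 + (W - h - k) * k) ≤ 12 * 4096 ^ 2 * B1 h W k := by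
      gcongr; exact (le_max_left _ _).trans (le_max_right _ _)
    have h3 : 12 * 4096 ^ 2 * (h * (W + h) / 2 - k ^ 2) ≤ 12 * 4096 ^ 2 * B1 h W k := by
      gcongr; exact (le_max_right _ _).trans (le_max_right _ _)
    have h0 : 0 ≤ 12 * 4096 ^ 2 * B1 h W k := by
      refine le_trans ?_ h1
      have : 0 ≤ h := by linarith
      have : 0 ≤ W := by linarith
      positivity
    rw [hB]
    rw [Nat.cast_max, Nat.cast_max]
    refine max_le ?_ (max_le ?_ ?_)
    · refine le_trans ?_ h1
      push_cast
      nlinarith [mul_le_mul hhl hw w0 (by linarith), mul_le_mul hhl hhl hl0 (by linarith)]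
    · refine cast_sub_le h0 ?_
      have : 12 * (4096 * k) ^ 2 ≤ 12 * (ku : ℝ) * ku := by nlinarith
      push_cast
      nlinarith [mul_le_mul hhl hw w0 (by linarith), mul_le_mul hhl hhl hl0 (by linarith)]
    · have h4 : 12 * 4096 ^ 2 * h ^ 2 ≤ 12 * 4096 ^ 2 * B1 h W k := by
        gcongr; exact sq_le_B1 (by linarith) (by linarith)
      have h5 : (hl : ℝ) * hl ≤ (4096 * h) * (4096 * h) :=
        mul_le_mul hhl hhl hl0 (by linarith)
      set m := min (2 * w * kl - (hl + kl) * kl) (2 * w * ku - (hl + ku) * ku) with hm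
      rcases Nat.eq_zero_or_pos m with h0 | hpos
      · rw [h0]; push_cast; linarith
      · rw [hm, gt_iff_lt, lt_min_iff] at hpos
        have hl' := Nat.cast_sub (R := ℝ) (Nat.sub_pos_iff_lt.1 hpos.1).le
        have hu' := Nat.cast_sub (R := ℝ) (Nat.sub_pos_iff_lt.1 hpos.2).le
        have : (m : ℝ) ≤ (2 * w - hl - 4096 * k) * (4096 * k) := by
          rw [hm, Nat.cast_min, hl', hu']
          push_cast
          rcases le_total (2 * w - hl - ku - 4096 * k : ℝ) 0 with h6 | h6
          · exact (min_le_right _ _).trans (by nlinarith)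
          · exact (min_le_left _ _).trans (by nlinarith)
        refine le_trans ?_ h2
        have h7 : 0 ≤ (4096 * h - hl) * (4096 * h + hl - 4096 * k) :=
          mul_nonneg (by linarith) (by linarith)
        have h8 : 0 ≤ (4096 * (W / 2) - w) * (4096 * k) := mul_nonneg (by linarith) (by linarith)
        push_cast
        linarith
  · refine le_trans ?_ (mul_le_mul_of_nonneg_left (sq_le_B2 (by linarith)) (by norm_num))
    push_cast
    nlinarith
lemma Xfun_eq (a b u : ℝ) :
    Xfun a b u = √(1 - max (u / 2) (u - min a (-b)) ^ 2) - u := by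
  unfold Xfun Tinv
  split_ifs with h
  · rw [max_eq_left (by linarith)]; ring_nf
  · rw [max_eq_right (by linarith)]

lemma yLo_le {w p q al au bu : ℕ} {T W a b : ℝ} (hw : (w : ℝ) ≤ 4096 * (W / 2))
    (hp : (p : ℝ) ≤ 4096 * (1 + T)) (hq : 4096 * (1 + T) ≤ q) (hal : (al : ℝ) ≤ 4096 * a)
    (hau : 4096 * a ≤ au) (hbu : 4096 * b ≤ bu) (hb : 0 ≤ b) :
    (yLo w p q al au bu : ℝ) ≤ 4096 * max (Yfun T a W b) 0 := by
  have hY := le_max_left (Yfun T a W b) 0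
  simp only [yLo, max'_eq, Nat.sub_eq, Nat.mul_eq, Nat.add_eq]
  set M := max (bu.succ ÷ 2) (max (bu + 4096 - p) (bu + q - (4096 + al))) with hM
  refine cast_sub_le (by positivity) ?_
  have hYX : Yfun T a W b = W / 2 - a + (√(1 - max (b / 2) (b - min T (-(T - a))) ^ 2) - b) := by
    rw [Yfun, Xfun_eq]
  set m := max (b / 2) (b - min T (-(T - a))) with hm
  have hm0 : 0 ≤ m := le_max_of_le_left (by linarith)
  have hmM : 4096 * m ≤ M := by
    rw [hm, hM, mul_max_of_nonneg _ _ (by norm_num), Nat.cast_max, Nat.cast_max]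
    refine max_le_max ?_ ?_
    · have : (bu : ℝ) ≤ 2 * (bu.succ / 2 : ℕ) := by
        have : bu ≤ 2 * (bu.succ / 2) := by omega
        exact_mod_cast this
      change _ ≤ ((bu.succ / 2 : ℕ) : ℝ)
      linarith
    · rcases min_choice T (-(T - a)) with h | h <;> rw [h]
      · exact le_max_of_le_left (le_cast_sub (by push_cast; linarith))
      · exact le_max_of_le_right (le_cast_sub (by push_cast; linarith))
  have hs : (sqrtLo (16777216 - M * M) : ℝ) ≤ 4096 * √(1 - m ^ 2) := by
    rw [mul_sqrt_eq (by norm_num)]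
    have hmM2 : (4096 * m) ^ 2 ≤ (M : ℝ) ^ 2 := by gcongr
    rcases le_total 0 (1 - m ^ 2) with h | h
    · refine sqrtLo_le (cast_sub_le (by positivity) ?_)
      push_cast
      linarith
    · have h' : 16777216 ≤ M * M := by
        have : (16777216 : ℝ) ≤ M * M := by nlinarith
        exact_mod_cast this
      rw [Nat.sub_eq_zero_of_le h']
      exact (sqrtLo_le (x := 0) (by simp)).trans (by simp)
  push_cast
  linarith [hYX]

lemma b3Lo_le {al bl y : ℕ} {T W a b : ℝ} (hal : (al : ℝ) ≤ 4096 * a) (hbl : (bl : ℝ) ≤ 4096 * b)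
    (hy : (y : ℝ) ≤ 4096 * max (Yfun T a W b) 0) :
    (b3Lo al bl y : ℝ) ≤ 12 * 4096 ^ 2 * B3 T a W b := by
  have hal' : (al : ℝ) * al ≤ (4096 * a) * (4096 * a) := by
    have : (0 : ℝ) ≤ al := by positivity
    exact mul_le_mul hal hal this (by linarith)
  have hbl' : (bl : ℝ) * bl ≤ (4096 * b) * (4096 * b) := by
    have : (0 : ℝ) ≤ bl := by positivity
    exact mul_le_mul hbl hbl this (by linarith)
  simp only [b3Lo, max'_eq, min'_eq, Nat.mul_eq, Nat.add_eq, B3]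
  set Y := max (Yfun T a W b) 0 with hY
  have hY0 : 0 ≤ Y := le_max_right _ _
  have hyY : (y : ℝ) * y ≤ (4096 * Y) * (4096 * Y) := by gcongr
  rw [mul_max_of_nonneg _ _ (by norm_num)]
  rcases le_total (y * bl) (min (y * y) (2 * bl * bl)) with h | h
  · rw [max_eq_right h]
    refine le_max_of_le_right ?_
    have : ((min (y * y) (2 * bl * bl) : ℕ) : ℝ) ≤ 4096 ^ 2 * min (Y ^ 2) (2 * b ^ 2) := by
      rw [mul_min_of_nonneg _ _ (by norm_num)]
      push_cast
      exact min_le_min (by linarith) (by linarith)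
    push_cast at this ⊢
    linarith
  · rw [max_eq_left h]
    refine le_max_of_le_left ?_
    have : (y : ℝ) * bl ≤ (4096 * Y) * (4096 * b) := by gcongr
    push_cast
    linarith

lemma sin_mul_four_sub_cos_le {x : ℝ} (hx : 0 ≤ x) :
    Real.sin x * (4 - Real.cos x) ≤ 3 * x := by
  let f : ℝ → ℝ := fun x => 3 * x - Real.sin x * (4 - Real.cos x)
  have hf (y : ℝ) : HasDerivAt f (2 * (1 - Real.cos y) ^ 2) y := by
    have h := ((hasDerivAt_id y).const_mul 3).sub
      ((Real.hasDerivAt_sin y).mul ((Real.hasDerivAt_cos y).const_sub 4))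
    exact h.congr_deriv (by linear_combination -Real.sin_sq_add_cos_sq y)
  have hmono : Monotone f := monotone_of_deriv_nonneg (fun y => (hf y).differentiableAt)
    fun y => by rw [(hf y).deriv]; positivity
  have := hmono hx
  simp only [f, Real.sin_zero] at this
  linarith

lemma le_Aseg {δ : ℝ} (h0 : 0 ≤ δ) (h1 : δ ≤ 1) : 4 / 3 * δ * √(2 * δ - δ ^ 2) ≤ Aseg δ := by
  have h := sin_mul_four_sub_cos_le (Real.arccos_nonneg (1 - δ))
  rw [Real.sin_arccos, Real.cos_arccos (by linarith) (by linarith)] at h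
  rw [Aseg, show 2 * δ - δ ^ 2 = 1 - (1 - δ) ^ 2 by ring]
  linarith

lemma le_B5 {e u v : ℕ} {d H : ℝ} (hd : d ≤ H) (hd0 : 0 ≤ d) (hH : H ≤ 1)
    (he : (e : ℝ) ≤ 4096 * (H - d))
    (hu : 4096 * (H - d) ≤ u) (hv : 4096 * d ≤ v) :
    ((e * (16 * sqrtLo (e * (8192 - e)) - 12 * v) : ℕ) : ℝ) ≤
      12 * 4096 ^ 2 * B5 d H + (u * (12 * v - 16 * sqrtLo (e * (8192 - e))) : ℕ) := by
  set δ := H - d with hδ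
  have hA := le_Aseg (δ := δ) (by linarith) (by linarith)
  have hB : B5 d H = Aseg δ - d * δ := by rw [B5, hδ]; ring
  have e0 : (0 : ℝ) ≤ e := by positivity
  have hg : (sqrtLo (e * (8192 - e)) : ℝ) ≤ 4096 * √(2 * δ - δ ^ 2) := by
    rw [mul_sqrt_eq (by norm_num)]
    apply sqrtLo_le
    have : e ≤ 8192 := by
      have : (e : ℝ) ≤ 8192 := by linarith
      exact_mod_cast this
    push_cast [Nat.cast_sub this]
    nlinarith
  set g := sqrtLo (e * (8192 - e))
  have hgv : (4096 * δ) * (16 * g - 12 * v) ≤ 12 * 4096 ^ 2 * B5 d H := by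
    have h1 : (4096 * δ) * (16 * g - 12 * v) ≤
        (4096 * δ) * (16 * (4096 * √(2 * δ - δ ^ 2)) - 12 * (4096 * d)) := by
      gcongr
    rw [hB]
    linarith
  rcases le_total (12 * v) (16 * g) with h | h
  · have h' : (12 * v : ℝ) ≤ 16 * g := by exact_mod_cast h
    rw [Nat.sub_eq_zero_of_le h]
    push_cast [Nat.cast_sub h]
    nlinarith
  · have h' : (16 * g : ℝ) ≤ 12 * v := by exact_mod_cast h
    rw [Nat.sub_eq_zero_of_le h]
    push_cast [Nat.cast_sub h]
    nlinarith
/-- The area bound of the theorem, with `T` in place of `Tinv s₁` and `A` in place of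
`s₁ ^ 2 + 0.83 * sigma s₁ ^ 2`. -/
def areaBound (A T a b c d : ℝ) : ℝ :=
  A + B5 d (1 + T - a - b - c) + (B4 T a (wfun T a) b + B4 (T - a) b (wfun (T - a) b) c +
    B4 (T - a - b) c (wfun (T - a - b) c) d)

lemma areaBound_of_testBox {K p q al au bl bu cl cu dl du : ℕ} {A T a b c d : ℝ}
    (htest : testBox K p q al au bl bu cl cu dl du = true)
    (hK : (K : ℝ) ≤ 12 * 4096 ^ 2 * A) (hp : (p : ℝ) ≤ 4096 * (1 + T)) (hq : 4096 * (1 + T) ≤ q)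
    (hT : T ≤ 1) (hd : 0 ≤ d) (hdc : d ≤ c) (hcb : c ≤ b) (hba : b ≤ a)
    (hdH : d ≤ 1 + T - a - b - c) (hH : 1 + T - a - b - c ≤ 1)
    (hal : (al : ℝ) ≤ 4096 * a) (hau : 4096 * a ≤ au)
    (hbl : (bl : ℝ) ≤ 4096 * b) (hbu : 4096 * b ≤ bu)
    (hcl : (cl : ℝ) ≤ 4096 * c) (hcu : 4096 * c ≤ cu)
    (hdl : (dl : ℝ) ≤ 4096 * d) (hdu : 4096 * d ≤ du) :
    8 / 5 < areaBound A T a b c d := by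
  have key (h : 322122548 ≤ 12 * 4096 ^ 2 * areaBound A T a b c d) :
      8 / 5 < areaBound A T a b c d := by linarith
  apply key
  have hw1 : (widthLo (p - au) q : ℝ) ≤ 4096 * (wfun T a / 2) :=
    widthLo_le (by linarith) hT (cast_sub_le (by linarith) (by linarith)) hq
  have hw2 : (widthLo (p - au - bu) (q - al) : ℝ) ≤ 4096 * (wfun (T - a) b / 2) := by
    refine widthLo_le (by linarith) (by linarith) ?_ (le_cast_sub (by linarith))
    rw [Nat.sub_sub]
    exact cast_sub_le (by linarith) (by push_cast; linarith)
  have hw3 : (widthLo (p - au - bu - cu) (q - al - bl) : ℝ) ≤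
      4096 * (wfun (T - a - b) c / 2) := by
    rw [Nat.sub_sub, Nat.sub_sub, Nat.sub_sub]
    exact widthLo_le (by linarith) (by linarith)
      (cast_sub_le (by linarith) (by push_cast; linarith)) (le_cast_sub (by push_cast; linarith))
  have hB1 := b2Lo_le hal hau hw1 hbl hbu hba
  have hB2 := b2Lo_le hbl hbu hw2 hcl hcu hcb
  have hB3 := b2Lo_le hcl hcu hw3 hdl hdu hdc
  have hB1' := b3Lo_le hal hbl (yLo_le hw1 hp hq hal hau hbu (by linarith))
  have hB5 := le_B5 (e := p - (au + bu + cu + du)) (u := q - (al + bl + cl + dl)) (v := du)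
    hdH hd hH (cast_sub_le (by linarith) (by push_cast; linarith))
    (le_cast_sub (by push_cast; linarith)) hdu
  simp only [testBox, or'_eq, force_eq, evalBox, enough, restLo, Bool.or_eq_true, Nat.ble_eq,
    Nat.sub_eq, Nat.mul_eq, Nat.add_eq] at htest
  generalize p - (au + bu + cu + du) = e at htest hB5
  generalize sqrtLo (e * (8192 - e)) = g at htest hB5
  generalize e * (16 * g - 12 * du) = x at htest hB5
  generalize (q - (al + bl + cl + dl)) * (12 * du - 16 * g) = y at htest hB5
  have h1 : B2 a (wfun T a) b ≤ B4 T a (wfun T a) b := le_max_left _ _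
  have h1' : B3 T a (wfun T a) b ≤ B4 T a (wfun T a) b := le_max_right _ _
  have h2 : B2 b (wfun (T - a) b) c ≤ B4 (T - a) b (wfun (T - a) b) c := le_max_left _ _
  have h3 : B2 c (wfun (T - a - b) c) d ≤ B4 (T - a - b) c (wfun (T - a - b) c) d :=
    le_max_left _ _
  rw [areaBound]
  rcases htest with h | h | h
  · have : ((q.succ : ℕ) : ℝ) ≤ ((al + bl + cl + dl : ℕ) : ℝ) := by exact_mod_cast h
    push_cast at this
    linarith
  · have := (Nat.cast_le (α := ℝ)).2 h
    rw [Nat.cast_add, Nat.cast_add, Nat.cast_add, Nat.cast_add, Nat.cast_add,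
      Nat.cast_ofNat] at this
    linarith
  · have := (Nat.cast_le (α := ℝ)).2 h
    rw [Nat.cast_add, Nat.cast_add, Nat.cast_add, Nat.cast_add, Nat.cast_add,
      Nat.cast_ofNat] at this
    linarith

lemma areaBound_of_search (n : ℕ) {K p q : ℕ} {A T a b c d : ℝ}
    (hK : (K : ℝ) ≤ 12 * 4096 ^ 2 * A) (hp : (p : ℝ) ≤ 4096 * (1 + T)) (hq : 4096 * (1 + T) ≤ q)
    (hT : T ≤ 1) (hd : 0 ≤ d) (hdc : d ≤ c) (hcb : c ≤ b) (hba : b ≤ a)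
    (hdH : d ≤ 1 + T - a - b - c) (hH : 1 + T - a - b - c ≤ 1) :
    ∀ {al au bl bu cl cu dl du : ℕ}, search n K p q al au bl bu cl cu dl du = true →
    (al : ℝ) ≤ 4096 * a → 4096 * a ≤ au → (bl : ℝ) ≤ 4096 * b → 4096 * b ≤ bu →
    (cl : ℝ) ≤ 4096 * c → 4096 * c ≤ cu → (dl : ℝ) ≤ 4096 * d → 4096 * d ≤ du →
    8 / 5 < areaBound A T a b c d := by
  induction n with
  | zero => intro _ _ _ _ _ _ _ _ h; exact absurd h Bool.false_ne_true
  | succ n ih =>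
    intro al au bl bu cl cu dl du h hal hau hbl hbu hcl hcu hdl hdu
    change (force (max' cl dl) fun cl => force (max' bl cl) fun bl => force (max' al bl) fun al =>
      force (min' bu au) fun bu => force (min' cu bu) fun cu => force (min' du cu) fun du =>
      step K p q (search n K p q) al au bl bu cl cu dl du) = true at h
    simp only [force_eq, max'_eq, min'_eq] at h
    have hcl : ((max cl dl : ℕ) : ℝ) ≤ 4096 * c := by
      rw [Nat.cast_max]; exact max_le hcl (by linarith)
    generalize max cl dl = cl at *
    have hbl : ((max bl cl : ℕ) : ℝ) ≤ 4096 * b := by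
      rw [Nat.cast_max]; exact max_le hbl (by linarith)
    generalize max bl cl = bl at *
    have hal : ((max al bl : ℕ) : ℝ) ≤ 4096 * a := by
      rw [Nat.cast_max]; exact max_le hal (by linarith)
    generalize max al bl = al at *
    have hbu : 4096 * b ≤ ((min bu au : ℕ) : ℝ) := by
      rw [Nat.cast_min]; exact le_min hbu (by linarith)
    generalize min bu au = bu at *
    have hcu : 4096 * c ≤ ((min cu bu : ℕ) : ℝ) := by
      rw [Nat.cast_min]; exact le_min hcu (by linarith)
    generalize min cu bu = cu at *
    have hdu : 4096 * d ≤ ((min du cu : ℕ) : ℝ) := by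
      rw [Nat.cast_min]; exact le_min hdu (by linarith)
    generalize min du cu = du at *
    rw [step, or'_eq, Bool.or_eq_true] at h
    rcases h with h | h
    · exact areaBound_of_testBox h hK hp hq hT hd hdc hcb hba hdH hH hal hau hbl hbu hcl hcu hdl hdu
    · simp only [bisect, ite'_eq, force_eq, and'_eq] at h
      split_ifs at h <;> rw [Bool.and_eq_true] at h
      · rcases le_total (4096 * a) (((al + au) ÷ 2 : ℕ) : ℝ) with hm | hm
        · exact ih h.1 hal hm hbl hbu hcl hcu hdl hdu
        · exact ih h.2 hm hau hbl hbu hcl hcu hdl hdu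
      · rcases le_total (4096 * b) (((bl + bu) ÷ 2 : ℕ) : ℝ) with hm | hm
        · exact ih h.1 hal hau hbl hm hcl hcu hdl hdu
        · exact ih h.2 hal hau hm hbu hcl hcu hdl hdu
      · rcases le_total (4096 * c) (((cl + cu) ÷ 2 : ℕ) : ℝ) with hm | hm
        · exact ih h.1 hal hau hbl hbu hcl hm hdl hdu
        · exact ih h.2 hal hau hbl hbu hm hcu hdl hdu
      · rcases le_total (4096 * d) (((dl + du) ÷ 2 : ℕ) : ℝ) with hm | hm
        · exact ih h.1 hal hau hbl hbu hcl hcu hdl hm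
        · exact ih h.2 hal hau hbl hbu hcl hcu hm hdu

lemma sqrt_le_halfHi (i : ℕ) : 4096 * √(1 - ((i : ℝ) / 64) ^ 2 / 4) ≤ halfHi i := by
  rw [mul_sqrt_eq (by norm_num)]
  refine sqrt_le_heron (Nat.succ_pos _) (le_cast_sub ?_)
  push_cast [Nat.mul_eq]
  linarith

lemma halfLo_le {i : ℕ} (hi : i ≤ 128) : (halfLo i : ℝ) ≤ 4096 * √(1 - ((i : ℝ) / 64) ^ 2 / 4) := by
  rw [mul_sqrt_eq (by norm_num)]
  refine cast_div_heron_le (Nat.succ_pos _) (cast_sub_le ?_ ?_)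
  · have : (i : ℝ) ≤ 128 := by exact_mod_cast hi
    have : (i : ℝ) * i ≤ 128 * 128 := by gcongr
    linarith
  · push_cast [Nat.mul_eq]
    linarith

lemma of_sigmaTest {r i : ℕ} (hi : i ≤ 128) (h : sigmaTest r i = true) {s x : ℝ}
    (hs : s = i / 64) (hx : x = r / 4096) :
    x ≤ s ∧ s ^ 2 + 2 * x ^ 2 - x * s ≤ 2 * √(1 - s ^ 2 / 4) * (s - x) := by
  simp only [sigmaTest, and'_eq, Bool.and_eq_true, Nat.ble_eq, Nat.sub_eq, Nat.mul_eq,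
    Nat.add_eq] at h
  obtain ⟨h1, h2⟩ := h
  have h1' : (r : ℝ) ≤ 64 * i := by exact_mod_cast h1
  have h2' := (Nat.cast_le (α := ℝ)).2 h2
  push_cast [Nat.cast_sub h1] at h2'
  have hxs : x ≤ s := by rw [hx, hs]; linarith
  refine ⟨hxs, ?_⟩
  have h3 := halfLo_le hi
  rw [← hs] at h3
  have h4 := mul_le_mul_of_nonneg_right h3 (sub_nonneg.2 h1')
  have hi' : (i : ℝ) = 64 * s := by rw [hs]; ring
  have hr' : (r : ℝ) = 4096 * x := by rw [hx]; ring
  rw [hi', hr'] at h2' h4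
  linarith

lemma le_sigma_of_le_s1star {s x : ℝ} (hs : s ≤ s1star) (hs2 : s ^ 2 ≤ 4)
    (h : s ^ 2 + 2 * x ^ 2 - x * s ≤ 2 * √(1 - s ^ 2 / 4) * (s - x)) : x ≤ sigma s := by
  rw [sigma, if_pos hs, Tinv]
  have hu := Real.sq_sqrt (show 0 ≤ 1 - s ^ 2 / 4 by linarith)
  generalize √(1 - s ^ 2 / 4) = u at *
  have : 4 * x - s + 2 * u ≤ √(8 - (s - 2 * (u - s)) ^ 2) :=
    (le_abs_self _).trans (Real.abs_le_sqrt (by linarith))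
  linarith

lemma sigma_condition_convex {l m s x : ℝ} (hl : 0 ≤ l) (hm : m ^ 2 ≤ 4) (hls : l ≤ s) (hsm : s ≤ m)
    (h1 : l ^ 2 + 2 * x ^ 2 - x * l ≤ 2 * √(1 - l ^ 2 / 4) * (l - x))
    (h2 : m ^ 2 + 2 * x ^ 2 - x * m ≤ 2 * √(1 - m ^ 2 / 4) * (m - x)) (hx : x ≤ l) :
    s ^ 2 + 2 * x ^ 2 - x * s ≤ 2 * √(1 - s ^ 2 / 4) * (s - x) := by
  obtain ⟨α, β, hα, hβ, hαβ, rfl⟩ : ∃ α β : ℝ, 0 ≤ α ∧ 0 ≤ β ∧ α + β = 1 ∧ α * l + β * m = s := by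
    have := (segment_eq_Icc (𝕜 := ℝ) (hls.trans hsm)).ge ⟨hls, hsm⟩
    simpa [segment] using this
  have hlm := hls.trans hsm
  have hul := Real.sq_sqrt (show 0 ≤ 1 - l ^ 2 / 4 by nlinarith)
  have hum := Real.sq_sqrt (show 0 ≤ 1 - m ^ 2 / 4 by linarith)
  have hlmu : √(1 - m ^ 2 / 4) ≤ √(1 - l ^ 2 / 4) := Real.sqrt_le_sqrt (by nlinarith)
  set u := √(1 - l ^ 2 / 4)
  set v := √(1 - m ^ 2 / 4)
  have hu : α * u + β * v ≤ √(1 - (α * l + β * m) ^ 2 / 4) := by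
    refine (le_abs_self _).trans (Real.abs_le_sqrt ?_)
    obtain rfl : β = 1 - α := by linarith
    nlinarith [mul_nonneg (mul_nonneg hα hβ) (sq_nonneg (u - v)),
      mul_nonneg (mul_nonneg hα hβ) (sq_nonneg (l - m))]
  have h3 := mul_le_mul_of_nonneg_right hu (show 0 ≤ α * l + β * m - x by linarith)
  obtain rfl : β = 1 - α := by linarith
  nlinarith [mul_le_mul_of_nonneg_left h1 hα, mul_le_mul_of_nonneg_left h2 hβ,
    mul_nonneg (mul_nonneg hα hβ) (mul_nonneg (sub_nonneg.2 hlmu) (sub_nonneg.2 hlm)),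
    mul_nonneg (mul_nonneg hα hβ) (sq_nonneg (l - m))]

lemma one_le_s1star : 1 ≤ s1star :=
  Real.one_le_sqrt.2 (by linarith [Real.one_le_sqrt.2 (one_le_two (α := ℝ))])

lemma sigmaLo_le {i : ℕ} {s : ℝ} (hi : i ≤ 80) (hl : (i : ℝ) / 64 ≤ s) (hu : s ≤ (i + 1) / 64)
    (h1 : sigmaTest (sigmaLo i) i = true) (h2 : sigmaTest (sigmaLo i) (i + 1) = true) :
    sigmaLo i / 4096 ≤ sigma s := by
  have hi' : (i : ℝ) ≤ 80 := by exact_mod_cast hi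
  have hi0 : (0 : ℝ) ≤ i := by positivity
  rcases le_or_gt s s1star with hs | hs
  · have h1' := of_sigmaTest (by omega) h1 rfl rfl
    have h2' := of_sigmaTest (s := (i + 1) / 64) (by omega) h2 (by push_cast; rfl) rfl
    refine le_sigma_of_le_s1star hs (by nlinarith) (sigma_condition_convex (by positivity) ?_ hl hu
      h1'.2 h2'.2 h1'.1)
    nlinarith
  · have hs1 := one_le_s1star.trans_lt hs
    have : 64 ≤ i := by
      have : (63 : ℝ) < i := by linarith
      exact_mod_cast this
    rw [sigma, if_neg hs.not_ge, sigmaLo, ite'_eq, if_pos (by rwa [Nat.ble_eq])]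
    have : 1433 / 4096 * 5 + 2 * s ≤ √(20 - s ^ 2) :=
      (le_abs_self _).trans (Real.abs_le_sqrt (by nlinarith))
    push_cast
    linarith

lemma areaBound_of_cellTest {i : ℕ} {s a b c d : ℝ} (hi : i ≤ 80) (htest : cellTest i = true)
    (hl : (i : ℝ) / 64 ≤ s) (hu : s ≤ (i + 1) / 64)
    (hd : 0 ≤ d) (hdc : d ≤ c) (hcb : c ≤ b) (hba : b ≤ a) (has : a ≤ s)
    (hdH : d ≤ 1 + Tinv s - a - b - c) (hH : 1 + Tinv s - a - b - c ≤ 1) :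
    8 / 5 < areaBound (s ^ 2 + 0.83 * sigma s ^ 2) (Tinv s) a b c d := by
  simp only [cellTest, force_eq, and'_eq, Bool.and_eq_true, Nat.sub_eq, Nat.mul_eq, Nat.add_eq,
    Nat.succ_eq_add_one] at htest
  obtain ⟨⟨h1, h2⟩, h⟩ := htest
  have hi0 : (0 : ℝ) ≤ i := by positivity
  have hi' : (i : ℝ) ≤ 80 := by exact_mod_cast hi
  have hσ := sigmaLo_le hi hl hu h1 h2
  have hlo := halfLo_le (i := i + 1) (by omega)
  push_cast at hlo
  have hhi := sqrt_le_halfHi i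
  have hu1 : √(1 - ((i + 1 : ℝ) / 64) ^ 2 / 4) ≤ √(1 - s ^ 2 / 4) :=
    Real.sqrt_le_sqrt (by nlinarith)
  have hu2 : √(1 - s ^ 2 / 4) ≤ √(1 - ((i : ℝ) / 64) ^ 2 / 4) :=
    Real.sqrt_le_sqrt (by nlinarith)
  have hu3 : √(1 - s ^ 2 / 4) ≤ 1 := Real.sqrt_le_one.2 (by nlinarith)
  have hT : Tinv s = √(1 - s ^ 2 / 4) - s := rfl
  refine areaBound_of_search 30 ?_ (cast_sub_le ?_ ?_) (le_cast_sub ?_) ?_ hd hdc hcb hba hdH hH h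
    ?_ ?_ ?_ ?_ ?_ ?_ ?_ ?_
  · have hr : ((249 * sigmaLo i * sigmaLo i ÷ 25 : ℕ) : ℝ) ≤ 249 / 25 * sigmaLo i ^ 2 :=
      cast_div_le' (by norm_num) (by push_cast; linarith)
    have hr' : (sigmaLo i / 4096 : ℝ) ^ 2 ≤ sigma s ^ 2 := by gcongr
    have hs' : ((i : ℝ) / 64) ^ 2 ≤ s ^ 2 := by gcongr
    rw [Nat.cast_add]
    push_cast
    linarith
  all_goals push_cast; linarith

lemma cellTest_of_cellsTest {i n j : ℕ} (h : cellsTest i n = true) (hij : i ≤ j) (hj : j < i + n) :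
    cellTest j = true := by
  induction n with
  | zero => omega
  | succ n ih =>
    have h : and' (cellTest (i + n)) (cellsTest i n) = true := h
    rw [and'_eq, Bool.and_eq_true] at h
    rcases Nat.lt_succ_iff_lt_or_eq.1 hj with hj | rfl
    exacts [ih h.2 hj, h.1]

lemma cellsTest_18_16 : cellsTest 18 16 = true := by decide +kernel

lemma cellsTest_34_5 : cellsTest 34 5 = true := by decide +kernel

lemma cellsTest_39_5 : cellsTest 39 5 = true := by decide +kernel

lemma cellsTest_44_8 : cellsTest 44 8 = true := by decide +kernel

lemma cellsTest_52_29 : cellsTest 52 29 = true := by decide +kernel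

lemma cellTest_eq_true {i : ℕ} (h1 : 18 ≤ i) (h2 : i ≤ 80) : cellTest i = true := by
  rcases lt_or_ge i 34 with h | h
  · exact cellTest_of_cellsTest cellsTest_18_16 h1 h
  rcases lt_or_ge i 39 with h' | h'
  · exact cellTest_of_cellsTest cellsTest_34_5 h h'
  rcases lt_or_ge i 44 with h | h
  · exact cellTest_of_cellsTest cellsTest_39_5 h' h
  rcases lt_or_ge i 52 with h' | h'
  · exact cellTest_of_cellsTest cellsTest_44_8 h h'
  · exact cellTest_of_cellsTest cellsTest_52_29 h' (by omega)

end BranchAndBound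

theorem many_subcontainers_below_center (s₁ h₁ h₂ h₃ h₄ : ℝ)
    (h4pos : 0 < h₄) (h43 : h₄ ≤ h₃) (h32 : h₃ ≤ h₂) (h21 : h₂ ≤ h₁) (h1s : h₁ ≤ s₁)
    (hs1lo : 0.295 ≤ s₁) (hs1hi : s₁ ≤ Real.sqrt (8 / 5))
    (hH0 : 0 ≤ 1 + Tinv s₁ - h₁ - h₂ - h₃) (hH1 : 1 + Tinv s₁ - h₁ - h₂ - h₃ ≤ 1)
    (hh4H : h₄ ≤ 1 + Tinv s₁ - h₁ - h₂ - h₃) :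
    s₁ ^ 2 + 0.83 * sigma s₁ ^ 2 + B5 h₄ (1 + Tinv s₁ - h₁ - h₂ - h₃) +
      (B4 (Tinv s₁) h₁ (wfun (Tinv s₁) h₁) h₂ +
       B4 (Tinv s₁ - h₁) h₂ (wfun (Tinv s₁ - h₁) h₂) h₃ +
       B4 (Tinv s₁ - h₁ - h₂) h₃ (wfun (Tinv s₁ - h₁ - h₂) h₃) h₄) > 8 / 5 := by
  have hs0 : 0 ≤ s₁ := le_trans (by norm_num) hs1lo
  have hlt : s₁ < 81 / 64 := hs1hi.trans_lt ((Real.sqrt_lt' (by norm_num)).2 (by norm_num))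
  have h1 : 18 ≤ ⌊64 * s₁⌋₊ := Nat.le_floor (by norm_num at hs1lo ⊢; linarith)
  have h2 : ⌊64 * s₁⌋₊ < 81 := (Nat.floor_lt (by positivity)).2 (by norm_num; linarith)
  have hl := Nat.floor_le (show 0 ≤ 64 * s₁ by positivity)
  have hu := Nat.lt_floor_add_one (64 * s₁)
  exact BranchAndBound.areaBound_of_cellTest (Nat.lt_succ_iff.1 h2)
    (BranchAndBound.cellTest_eq_true h1 (Nat.lt_succ_iff.1 h2)) (by linarith) (by linarith)
    h4pos.le h43 h32 h21 h1s hh4H hH1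
end
end

section
/- The five axis-parallel squares [−√2/2, 0] × [−√2/2, 0], [0, √2/2] × [−√2/2, 0], [−√2/2, 0] × [0, √2/2], [0, √2/2] × [0, √2/2] (each of side length 1/√2) and [−√2/10, √2/10] × [√2/2, 7√2/10] (of side length √2/5) are all contained in the closed unit disk and have pairwise disjoint interiors; hence four squares of side 1/√2 and one square of side √2/5 can be packed simultaneously into the closed unit disk. -/
noncomputable section
open Set Metric

abbrev Plane := EuclideanSpace ℝ (Fin 2)

def unitDisk : Set Plane := closedBall 0 1

/-- The axis-parallel box [a,b] × [c,d] in the plane. -/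
def box (a b c d : ℝ) : Set Plane := {p | p 0 ∈ Icc a b ∧ p 1 ∈ Icc c d}

/-- The five squares of the packing in Case (C2). -/
def S : Fin 5 → Set Plane
  | 0 => box (-(Real.sqrt 2 / 2)) 0 (-(Real.sqrt 2 / 2)) 0
  | 1 => box 0 (Real.sqrt 2 / 2) (-(Real.sqrt 2 / 2)) 0
  | 2 => box (-(Real.sqrt 2 / 2)) 0 0 (Real.sqrt 2 / 2)
  | 3 => box 0 (Real.sqrt 2 / 2) 0 (Real.sqrt 2 / 2)
  | 4 => box (-(Real.sqrt 2 / 10)) (Real.sqrt 2 / 10) (Real.sqrt 2 / 2) (7 * Real.sqrt 2 / 10)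

theorem box_subset_unitDisk {a b c d r s : ℝ} (ha : -r ≤ a) (hb : b ≤ r) (hc : -s ≤ c)
    (hd : d ≤ s) (h : r ^ 2 + s ^ 2 ≤ 1) : box a b c d ⊆ unitDisk := by
  rintro p ⟨⟨h₁, h₂⟩, h₃, h₄⟩
  have hx : p 0 ^ 2 ≤ r ^ 2 := sq_le_sq' (by linarith) (by linarith)
  have hy : p 1 ^ 2 ≤ s ^ 2 := sq_le_sq' (by linarith) (by linarith)
  rw [unitDisk, mem_closedBall_zero_iff, EuclideanSpace.norm_eq, Real.sqrt_le_iff]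
  simp only [Fin.sum_univ_two, Real.norm_eq_abs, sq_abs]
  exact ⟨zero_le_one, by linarith⟩

theorem interior_box_subset (a b c d : ℝ) :
    interior (box a b c d) ⊆ {p | p 0 ∈ Ioo a b ∧ p 1 ∈ Ioo c d} := by
  have hopen (i : Fin 2) : IsOpenMap (fun p : Plane => p i) :=
    (EuclideanSpace.proj i : Plane →L[ℝ] ℝ).isOpenMap
      fun x => ⟨EuclideanSpace.single i x, by simp⟩
  intro p hp
  have key (i : Fin 2) (u v : ℝ) (h : box a b c d ⊆ (fun q : Plane => q i) ⁻¹' Icc u v) :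
      p i ∈ Ioo u v := by
    rw [← interior_Icc]
    exact interior_mono (image_subset_iff.2 h)
      ((hopen i).image_interior_subset _ (mem_image_of_mem _ hp))
  exact ⟨key 0 a b fun q hq => hq.1, key 1 c d fun q hq => hq.2⟩

theorem disjoint_interior_box {a b c d a' b' c' d' : ℝ}
    (h : b ≤ a' ∨ b' ≤ a ∨ d ≤ c' ∨ d' ≤ c) :
    Disjoint (interior (box a b c d)) (interior (box a' b' c' d')) := by
  refine Set.disjoint_left.2 fun p hp hq => ?_
  obtain ⟨⟨h₁, h₂⟩, h₃, h₄⟩ := interior_box_subset _ _ _ _ hp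
  obtain ⟨⟨h₅, h₆⟩, h₇, h₈⟩ := interior_box_subset _ _ _ _ hq
  rcases h with h | h | h | h <;> linarith

theorem five_squares_pack_case_two :
    (∀ i, S i ⊆ unitDisk) ∧
    (∀ i j, i ≠ j → Disjoint (interior (S i)) (interior (S j))) := by
  have hs : Real.sqrt 2 ^ 2 = 2 := Real.sq_sqrt (by norm_num)
  have hpos : 0 < Real.sqrt 2 := by positivity
  constructor
  · intro i
    fin_cases i
    on_goal 5 =>
      exact box_subset_unitDisk (r := Real.sqrt 2 / 10) (s := 7 * Real.sqrt 2 / 10)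
        (by linarith) (by linarith) (by linarith) (by linarith) (by linarith)
    all_goals
      exact box_subset_unitDisk (r := Real.sqrt 2 / 2) (s := Real.sqrt 2 / 2)
        (by linarith) (by linarith) (by linarith) (by linarith) (by linarith)
  · intro i j hij
    fin_cases i <;> fin_cases j <;> first
      | exact absurd rfl hij
      | exact disjoint_interior_box (.inl (by linarith))
      | exact disjoint_interior_box (.inr (.inl (by linarith)))
      | exact disjoint_interior_box (.inr (.inr (.inl (by linarith))))
      | exact disjoint_interior_box (.inr (.inr (.inr (by linarith))))
end
end
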